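/- arXiv:2504.08302 — 10 statements merged into one kernel-verified Lean document; each statement's English description precedes it below -/
import Mathlib

section
/- Let q_1, …, q_p ∈ ℝ^{1×N} be row vectors such that the stacked matrix Q_p = col(q_1, …, q_p) ∈ ℝ^{p×N} has full row rank, and let α_1, …, α_p be positive reals. Then for all i, s ∈ {1, …, p}, α_i · q_i · (∑_{j=1}^p α_j q_jᵀ q_j)† · q_sᵀ = δ_{is} (the Kronecker delta), where † denotes the Moore–Penrose pseudoinverse of the N×N matrix ∑_{j=1}^p α_j q_jᵀ q_j. -/
open Matrix

/-- `X` is the Moore–Penrose pseudoinverse of `M`, characterized by the four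
Penrose equations. -/
def IsMoorePenroseInv {m n : ℕ} (M : Matrix (Fin m) (Fin n) ℝ)
    (X : Matrix (Fin n) (Fin m) ℝ) : Prop :=
  M * X * M = M ∧ X * M * X = X ∧ (M * X)ᵀ = M * X ∧ (X * M)ᵀ = X * M

/-- A matrix of full row rank has a right inverse. -/
theorem Matrix.exists_mul_eq_one_of_rank_eq_card {m n K : Type*} [Fintype m] [DecidableEq m]
    [Fintype n] [Field K] (A : Matrix m n K) (hA : A.rank = Fintype.card m) :
    ∃ B : Matrix n m K, A * B = 1 := by
  rw [← Matrix.mulVec_surjective_iff_exists_right_inverse]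
  have h : LinearMap.range A.mulVecLin = ⊤ :=
    Submodule.eq_top_of_finrank_eq (by rw [← Matrix.rank, hA, Module.finrank_fintype_fun_eq_card])
  exact LinearMap.range_eq_top.mp h

/-- A generalized inverse `X` of `Qᵀ D Q`, with `Q` of full row rank and `D` invertible diagonal,
satisfies `D (Q X Qᵀ) = 1`. -/
theorem Matrix.diagonal_mul_conj_eq_one {m n K : Type*} [Fintype m] [DecidableEq m]
    [Fintype n] [Field K] (Q : Matrix m n K) (hQ : Q.rank = Fintype.card m)
    (d : m → K) (hd : ∀ j, d j ≠ 0) (X : Matrix n n K)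
    (hX : (Qᵀ * diagonal d * Q) * X * (Qᵀ * diagonal d * Q) = Qᵀ * diagonal d * Q) :
    diagonal d * (Q * X * Qᵀ) = 1 := by
  obtain ⟨R, hR⟩ := Q.exists_mul_eq_one_of_rank_eq_card hQ
  have hR' : Rᵀ * Qᵀ = 1 := by rw [← transpose_mul, hR, transpose_one]
  have hD : diagonal d * diagonal d⁻¹ = 1 := by
    rw [diagonal_mul_diagonal, ← diagonal_one]
    exact congrArg diagonal (funext fun j => mul_inv_cancel₀ (hd j))
  calc diagonal d * (Q * X * Qᵀ)
      = (Rᵀ * Qᵀ) * diagonal d * (Q * X * Qᵀ) * (diagonal d * (Q * R) * diagonal d⁻¹) := by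
        rw [hR, hR', Matrix.mul_one, hD, Matrix.one_mul, Matrix.mul_one]
    _ = Rᵀ * ((Qᵀ * diagonal d * Q) * X * (Qᵀ * diagonal d * Q)) * R * diagonal d⁻¹ := by
        simp only [Matrix.mul_assoc]
    _ = (Rᵀ * Qᵀ) * diagonal d * (Q * R) * diagonal d⁻¹ := by
        rw [hX]; simp only [Matrix.mul_assoc]
    _ = 1 := by rw [hR, hR', Matrix.one_mul, Matrix.mul_one, hD]

/-- if the stacked matrix `col(q_1, …, q_p) ∈ ℝ^{p×N}` has full row rank
and `α_j > 0`, then `α_i · q_i · (∑_j α_j q_jᵀ q_j)† · q_sᵀ = δ_{is}`. -/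
theorem direct_method_core {N p : ℕ}
    (q : Fin p → Matrix (Fin 1) (Fin N) ℝ)
    (hrank : (Matrix.of fun i j => q i 0 j : Matrix (Fin p) (Fin N) ℝ).rank = p)
    (α : Fin p → ℝ) (hα : ∀ j, 0 < α j)
    (X : Matrix (Fin N) (Fin N) ℝ)
    (hX : IsMoorePenroseInv (∑ j, α j • ((q j)ᵀ * q j)) X)
    (i s : Fin p) :
    α i • (q i * X * (q s)ᵀ) = if i = s then (1 : Matrix (Fin 1) (Fin 1) ℝ) else 0 := by
  set Q : Matrix (Fin p) (Fin N) ℝ := Matrix.of fun i j => q i 0 j with hQ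
  have hM : ∑ j, α j • ((q j)ᵀ * q j) = Qᵀ * diagonal α * Q := by
    ext a b
    rw [Matrix.sum_apply, Matrix.mul_apply]
    refine Finset.sum_congr rfl fun j _ => ?_
    rw [mul_diagonal, Matrix.smul_apply, Matrix.mul_apply, Fin.sum_univ_one]
    simp only [transpose_apply, smul_eq_mul, hQ, of_apply]
    ring
  have h := congrFun (congrFun (Q.diagonal_mul_conj_eq_one (by simpa using hrank) α
    (fun j => (hα j).ne') X (hM ▸ hX.1)) i) s
  rw [diagonal_mul, one_apply] at h
  have hent : (Q * X * Qᵀ) i s = (q i * X * (q s)ᵀ) 0 0 := by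
    simp [Matrix.mul_apply, hQ]
  ext a b
  rw [Subsingleton.elim a 0, Subsingleton.elim b 0, Matrix.smul_apply, smul_eq_mul, ← hent, h]
  split_ifs <;> simp
end

section
/- Let Y_1, …, Y_N ∈ ℝ^{n×n}, let w_1, …, w_N be real scalars, and let q_1, …, q_N ∈ ℝ^{1×N} be row vectors such that the stacked matrix Q = col(q_1, …, q_N) ∈ ℝ^{N×N} is invertible. Define ũ = ∑_{j=1}^N w_j Y_jᵀ (q_j ⊗ I_n) ∈ ℝ^{n×Nn}. Then ∑_{j=1}^N w_j² Y_jᵀ Y_j = ũ · ((∑_{j=1}^N q_jᵀ q_j)⁻¹ ⊗ I_n) · ũᵀ (note that ∑_{j=1}^N q_jᵀ q_j = Qᵀ Q is invertible). -/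
open Matrix
open scoped Kronecker

/-- The block row `[w₁ Y₁ᵀ, …, w_N Y_Nᵀ]`. -/
def weightedTransposeRow {m n N : Type*} (Y : N → Matrix m n ℝ) (w : N → ℝ) :
    Matrix n (N × m) ℝ :=
  of fun a p => w p.1 * Y p.1 p.2 a

lemma weightedTransposeRow_mul_transpose {m n N : Type*} [Fintype m] [Fintype N]
    (Y : N → Matrix m n ℝ) (w : N → ℝ) :
    weightedTransposeRow Y w * (weightedTransposeRow Y w)ᵀ
      = ∑ j, (w j) ^ 2 • ((Y j)ᵀ * Y j) := by
  ext a b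
  simp only [weightedTransposeRow, mul_apply, transpose_apply, of_apply, Matrix.sum_apply,
    Matrix.smul_apply, smul_eq_mul, Fintype.sum_prod_type, Finset.mul_sum]
  exact Finset.sum_congr rfl fun j _ => Finset.sum_congr rfl fun c _ => by ring

lemma weightedTransposeRow_mul_kronecker_one {m n N : Type*} [Fintype m] [DecidableEq m]
    [Fintype N] (Y : N → Matrix m n ℝ) (w : N → ℝ) (q : N → Matrix (Fin 1) N ℝ) :
    weightedTransposeRow Y w * ((of fun i j => q i 0 j) ⊗ₖ (1 : Matrix m m ℝ))
      = ∑ j, w j • ((Y j)ᵀ *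
        ((q j ⊗ₖ (1 : Matrix m m ℝ)).submatrix (fun a : m => ((0 : Fin 1), a)) id)) := by
  ext a b
  simp only [weightedTransposeRow, mul_apply, transpose_apply, of_apply, Matrix.sum_apply,
    Matrix.smul_apply, smul_eq_mul, Fintype.sum_prod_type, Finset.mul_sum, submatrix_apply,
    kroneckerMap_apply, id, mul_assoc]

lemma sum_transpose_mul_self_eq {N : Type*} [Fintype N] (q : N → Matrix (Fin 1) N ℝ) :
    ∑ j, (q j)ᵀ * q j
      = (of fun i j => q i 0 j : Matrix N N ℝ)ᵀ * of fun i j => q i 0 j := by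
  ext a b
  simp [Matrix.sum_apply, mul_apply]

lemma mul_inv_transpose_mul_self_mul_transpose {N : Type*} [Fintype N] [DecidableEq N]
    (Q : Matrix N N ℝ) (hQ : IsUnit Q.det) : Q * (Qᵀ * Q)⁻¹ * Qᵀ = 1 := by
  rw [Matrix.mul_inv_rev, ← Matrix.mul_assoc, mul_nonsing_inv Q hQ, Matrix.one_mul,
    nonsing_inv_mul Qᵀ (by rwa [det_transpose])]

/-- quadratic weighted sum decomposition,
`∑_j w_j² Y_jᵀ Y_j = ũ ((∑_j q_jᵀ q_j)⁻¹ ⊗ I_n) ũᵀ` where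
`ũ = ∑_j w_j Y_jᵀ (q_j ⊗ I_n)` and the stacked matrix `Q = col(q_1,…,q_N)` is invertible. -/
theorem direct_method_decomposition {n N : ℕ}
    (Y : Fin N → Matrix (Fin n) (Fin n) ℝ)
    (w : Fin N → ℝ)
    (q : Fin N → Matrix (Fin 1) (Fin N) ℝ)
    (hQ : IsUnit (Matrix.of fun i j => q i 0 j : Matrix (Fin N) (Fin N) ℝ).det)
    (u : Matrix (Fin n) (Fin N × Fin n) ℝ)
    (hu : u = ∑ j, w j • ((Y j)ᵀ *
      ((q j ⊗ₖ (1 : Matrix (Fin n) (Fin n) ℝ)).submatrix (fun a : Fin n => ((0 : Fin 1), a)) id))) :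
    ∑ j, (w j) ^ 2 • ((Y j)ᵀ * Y j)
      = u * ((∑ j, (q j)ᵀ * q j)⁻¹ ⊗ₖ (1 : Matrix (Fin n) (Fin n) ℝ)) * uᵀ := by
  rw [← weightedTransposeRow_mul_kronecker_one] at hu
  rw [hu, sum_transpose_mul_self_eq, ← weightedTransposeRow_mul_transpose]
  set Q : Matrix (Fin N) (Fin N) ℝ := of fun i j => q i 0 j
  set V := weightedTransposeRow Y w
  set J : Matrix (Fin n) (Fin n) ℝ := 1 with hJ
  have hK : (Q ⊗ₖ J) * ((Qᵀ * Q)⁻¹ ⊗ₖ J) * (Qᵀ ⊗ₖ J) = 1 := by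
    rw [← mul_kronecker_mul, ← mul_kronecker_mul,
      mul_inv_transpose_mul_self_mul_transpose Q hQ, hJ, Matrix.one_mul, Matrix.one_mul,
      one_kronecker_one]
  have hT : (Q ⊗ₖ J)ᵀ = Qᵀ ⊗ₖ J := by
    rw [← kroneckerMap_transpose, hJ, transpose_one]
  calc V * Vᵀ
      = V * ((Q ⊗ₖ J) * ((Qᵀ * Q)⁻¹ ⊗ₖ J) * (Qᵀ ⊗ₖ J)) * Vᵀ := by rw [hK, Matrix.mul_one]
    _ = V * (Q ⊗ₖ J) * ((Qᵀ * Q)⁻¹ ⊗ₖ J) * (V * (Q ⊗ₖ J))ᵀ := by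
      rw [transpose_mul, hT]
      simp only [Matrix.mul_assoc]
end

section
/- Let X_1, …, X_N ∈ ℝ^{n×n} be symmetric positive semidefinite, let w_1, …, w_N be nonnegative reals, and let c_1, …, c_N be reals with c_j > 0 whenever w_j > 0. Define Ũ = (1/N) ∑_{j : w_j > 0} (w_j²/c_j) X_j and X̃ = ∑_{j=1}^N w_j² X_j, and set α = max_{j : w_j > 0} |1/(N c_j) − 1| (with α = 0 if no w_j is positive). Then ‖Ũ − X̃‖₂ ≤ α ‖X̃‖₂, where ‖·‖₂ denotes the spectral norm (largest singular value). -/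
open Matrix Finset

/-- The spectral norm (largest singular value) of a real matrix: the operator norm of the
associated linear map between Euclidean spaces. -/
noncomputable def specNorm {a b : ℕ} (M : Matrix (Fin a) (Fin b) ℝ) : ℝ :=
  ‖(Matrix.toEuclideanLin (𝕜 := ℝ) (m := Fin a) (n := Fin b)).trans
      LinearMap.toContinuousLinearMap M‖

/-- If `|xᵀAx| ≤ a · xᵀBx` for every `x`, with `A` symmetric, then `‖A‖₂ ≤ a ‖B‖₂`. -/
theorem specNorm_le_mul_of_abs_dotProduct_le {n : ℕ} {A B : Matrix (Fin n) (Fin n) ℝ}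
    (hA : A.IsSymm) {a : ℝ} (ha : 0 ≤ a)
    (h : ∀ x : Fin n → ℝ, |x ⬝ᵥ A *ᵥ x| ≤ a * (x ⬝ᵥ B *ᵥ x)) :
    specNorm A ≤ a * specNorm B := by
  have rayleigh (M : Matrix (Fin n) (Fin n) ℝ) (x : EuclideanSpace ℝ (Fin n)) :
      (toEuclideanCLM (𝕜 := ℝ) M).rayleighQuotient x =
        (x.ofLp ⬝ᵥ M *ᵥ x.ofLp) / ‖x‖ ^ 2 := by
    rw [ContinuousLinearMap.rayleighQuotient, ContinuousLinearMap.reApplyInnerSelf_apply,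
      real_inner_comm, inner_toEuclideanCLM, RCLike.re_to_real]
  have hsymm : (toEuclideanCLM (𝕜 := ℝ) A).toLinearMap.IsSymmetric :=
    isSymmetric_toEuclideanLin_iff.mpr ((conjTranspose_eq_transpose_of_trivial A).trans hA)
  change ‖toEuclideanCLM (𝕜 := ℝ) A‖ ≤ a * ‖toEuclideanCLM (𝕜 := ℝ) B‖
  rw [ContinuousLinearMap.norm_eq_iSup_rayleighQuotient _ hsymm]
  refine ciSup_le fun x => ?_
  calc |(toEuclideanCLM (𝕜 := ℝ) A).rayleighQuotient x|
      = |x.ofLp ⬝ᵥ A *ᵥ x.ofLp| / ‖x‖ ^ 2 := by rw [rayleigh, abs_div, abs_sq]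
    _ ≤ a * (x.ofLp ⬝ᵥ B *ᵥ x.ofLp) / ‖x‖ ^ 2 := by gcongr; exact h x.ofLp
    _ = a * (toEuclideanCLM (𝕜 := ℝ) B).rayleighQuotient x := by rw [rayleigh, mul_div_assoc]
    _ ≤ a * ‖toEuclideanCLM (𝕜 := ℝ) B‖ := by
      gcongr
      exact (le_abs_self _).trans (ContinuousLinearMap.rayleighQuotient_le_norm _ x)

theorem dotProduct_sum_smul_mulVec {ι m : Type*} [Fintype m] (s : Finset ι) (r : ι → ℝ)
    (X : ι → Matrix m m ℝ) (x : m → ℝ) :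
    x ⬝ᵥ (∑ j ∈ s, r j • X j) *ᵥ x = ∑ j ∈ s, r j * (x ⬝ᵥ X j *ᵥ x) := by
  simp [sum_mulVec, dotProduct_sum, smul_mulVec, dotProduct_smul]

/-- Perturbing each coefficient of a nonnegative combination of positive semidefinite matrices
by a relative error of at most `a` changes it by at most `a` times its spectral norm. -/
theorem specNorm_sum_smul_le_of_abs_le {ι : Type*} {n : ℕ} (s : Finset ι)
    {X : ι → Matrix (Fin n) (Fin n) ℝ} (hX : ∀ j ∈ s, (X j).PosSemidef)
    {r d : ι → ℝ} {a : ℝ} (ha : 0 ≤ a) (hd : ∀ j ∈ s, |d j| ≤ a * r j) :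
    specNorm (∑ j ∈ s, d j • X j) ≤ a * specNorm (∑ j ∈ s, r j • X j) := by
  refine specNorm_le_mul_of_abs_dotProduct_le ?_ ha fun x => ?_
  · rw [IsSymm, transpose_sum]
    refine sum_congr rfl fun j hj => ?_
    rw [transpose_smul, ← conjTranspose_eq_transpose_of_trivial, (hX j hj).isHermitian.eq]
  · rw [dotProduct_sum_smul_mulVec, dotProduct_sum_smul_mulVec, mul_sum]
    refine (abs_sum_le_sum_abs _ _).trans (sum_le_sum fun j hj => ?_)
    have hq : 0 ≤ x ⬝ᵥ X j *ᵥ x := by simpa using (hX j hj).dotProduct_mulVec_nonneg x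
    rw [abs_mul, abs_of_nonneg hq, ← mul_assoc]
    exact mul_le_mul_of_nonneg_right (hd j hj) hq

/-- with `Ũ = (1/N) ∑_{j : w_j > 0} (w_j²/c_j) X_j`, `X̃ = ∑_j w_j² X_j` and
`α = max_{j : w_j > 0} |1/(N c_j) − 1|` (with `α = 0` if no `w_j` is positive),
one has `‖Ũ − X̃‖₂ ≤ α ‖X̃‖₂` in spectral norm. -/
theorem weighted_sum_spectral_bound {n N : ℕ}
    (X : Fin N → Matrix (Fin n) (Fin n) ℝ)
    (hXsymm : ∀ j, (X j).IsSymm) (hXpsd : ∀ j, (X j).PosSemidef)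
    (w c : Fin N → ℝ) (hw : ∀ j, 0 ≤ w j) (hc : ∀ j, 0 < w j → 0 < c j)
    (U Xt : Matrix (Fin n) (Fin n) ℝ)
    (hU : U = (1 / (N : ℝ)) •
      ∑ j ∈ Finset.univ.filter (fun j => 0 < w j), ((w j) ^ 2 / c j) • X j)
    (hXt : Xt = ∑ j, (w j) ^ 2 • X j)
    (α : ℝ)
    (hα : α = if h : (Finset.univ.filter (fun j : Fin N => 0 < w j)).Nonempty
      then (Finset.univ.filter (fun j : Fin N => 0 < w j)).sup' h
        (fun j => |1 / ((N : ℝ) * c j) - 1|)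
      else 0) :
    specNorm (U - Xt) ≤ α * specNorm Xt := by
  set s := Finset.univ.filter (fun j : Fin N => 0 < w j) with hs
  have hα_le : ∀ j ∈ s, |1 / ((N : ℝ) * c j) - 1| ≤ α := fun j hj => by
    rw [hα, dif_pos ⟨j, hj⟩]
    exact le_sup' (fun j => |1 / ((N : ℝ) * c j) - 1|) hj
  have hα_nonneg : 0 ≤ α := by
    rcases s.eq_empty_or_nonempty with h | ⟨j, hj⟩
    · rw [hα, dif_neg (not_nonempty_iff_eq_empty.mpr h)]
    · exact (abs_nonneg _).trans (hα_le j hj)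
  have hXt_s : Xt = ∑ j ∈ s, (w j) ^ 2 • X j := by
    rw [hXt]
    refine (sum_subset (subset_univ s) fun j _ hj => ?_).symm
    have hwj : w j = 0 := le_antisymm (by simpa [hs] using hj) (hw j)
    simp [hwj]
  have hdiff : U - Xt = ∑ j ∈ s, ((w j) ^ 2 * (1 / ((N : ℝ) * c j) - 1)) • X j := by
    rw [hU, hXt_s, smul_sum, ← sum_sub_distrib]
    refine sum_congr rfl fun j _ => ?_
    rw [smul_smul, ← sub_smul]
    congr 1
    rw [one_div_mul_eq_div, div_div, mul_comm (c j), mul_sub, mul_one_div, mul_one]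
  rw [hdiff, hXt_s]
  refine specNorm_sum_smul_le_of_abs_le s (fun j _ => hXpsd j) hα_nonneg fun j hj => ?_
  rw [abs_mul, abs_sq, mul_comm]
  exact mul_le_mul_of_nonneg_right (hα_le j hj) (sq_nonneg _)
end

section
/- Let L ∈ ℝ^{N×N} be symmetric with L·𝟙_N = 𝟙_N, and let r ∈ [0, 1) be such that ‖L x‖₂ ≤ r ‖x‖₂ for every x ∈ ℝ^N orthogonal to 𝟙_N. If k ≥ 1 is an integer with N r^k < 1, then for all indices i, j ∈ {1, …, N}: (L^k)_{ij} ≥ 1/N − r^k > 0 and |1/(N (L^k)_{ij}) − 1| ≤ N r^k / (1 − N r^k). -/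
open Matrix Finset

/-- A symmetric matrix fixing the all-ones vector preserves the sum of coordinates. -/
theorem sum_mulVec_eq_of_isSymm {ι : Type*} [Fintype ι] {L : Matrix ι ι ℝ} (hsymm : L.IsSymm)
    (hones : L.mulVec (fun _ => 1) = fun _ => 1) (x : ι → ℝ) :
    ∑ i, L.mulVec x i = ∑ i, x i := by
  have h : (fun _ => (1 : ℝ)) ⬝ᵥ L.mulVec x = (fun _ => 1) ⬝ᵥ x := by
    rw [dotProduct_mulVec, ← mulVec_transpose, hsymm.eq, hones]
  simpa [dotProduct] using h

/-- Contraction on the complement of the all-ones vector iterates to matrix powers. -/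
theorem sqrt_sum_sq_pow_mulVec_le {ι : Type*} [Fintype ι] [DecidableEq ι] {L : Matrix ι ι ℝ}
    (hsymm : L.IsSymm) (hones : L.mulVec (fun _ => 1) = fun _ => 1) {r : ℝ} (hr0 : 0 ≤ r)
    (hcontract : ∀ x : ι → ℝ, ∑ i, x i = 0 →
      Real.sqrt (∑ i, (L.mulVec x i) ^ 2) ≤ r * Real.sqrt (∑ i, (x i) ^ 2))
    {x : ι → ℝ} (hx : ∑ i, x i = 0) (m : ℕ) :
    ∑ i, (L ^ m).mulVec x i = 0 ∧
      Real.sqrt (∑ i, ((L ^ m).mulVec x i) ^ 2) ≤ r ^ m * Real.sqrt (∑ i, (x i) ^ 2) := by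
  induction m with
  | zero => simp [hx]
  | succ m ih =>
    rw [pow_succ', ← mulVec_mulVec]
    refine ⟨(sum_mulVec_eq_of_isSymm hsymm hones _).trans ih.1, (hcontract _ ih.1).trans ?_⟩
    rw [pow_succ', mul_assoc]
    exact mul_le_mul_of_nonneg_left ih.2 hr0

/-- Powers of a matrix fixing the all-ones vector fix it too. -/
theorem pow_mulVec_ones {ι : Type*} [Fintype ι] [DecidableEq ι] {L : Matrix ι ι ℝ}
    (hones : L.mulVec (fun _ => 1) = fun _ => 1) (m : ℕ) :
    (L ^ m).mulVec (fun _ => 1) = fun _ => 1 := by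
  induction m with
  | zero => simp
  | succ m ih => rw [pow_succ, ← mulVec_mulVec, hones, ih]

/-- Entries of powers are within `r ^ k` of the uniform value `1 / N`. -/
theorem abs_pow_apply_sub_le {N : ℕ} {L : Matrix (Fin N) (Fin N) ℝ}
    (hsymm : L.IsSymm) (hones : L.mulVec (fun _ => 1) = fun _ => 1) {r : ℝ} (hr0 : 0 ≤ r)
    (hcontract : ∀ x : Fin N → ℝ, ∑ i, x i = 0 →
      Real.sqrt (∑ i, (L.mulVec x i) ^ 2) ≤ r * Real.sqrt (∑ i, (x i) ^ 2))
    (k : ℕ) (i j : Fin N) : |(L ^ k) i j - 1 / (N : ℝ)| ≤ r ^ k := by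
  have hN : (0 : ℝ) < N := by exact_mod_cast i.pos
  set x : Fin N → ℝ := Pi.single j 1 - (1 / (N : ℝ)) • (fun _ => 1) with hx
  have hsum : ∑ l, x l = 0 := by
    simp [hx, Finset.sum_sub_distrib, hN.ne']
  have hval : (L ^ k).mulVec x i = (L ^ k) i j - 1 / (N : ℝ) := by
    rw [hx, mulVec_sub, mulVec_smul, pow_mulVec_ones hones]
    simp
  have hnorm : ∑ l, (x l) ^ 2 ≤ 1 := by
    have h : ∑ l, (x l) ^ 2 = x j - (1 / (N : ℝ)) * ∑ l, x l := by
      have h' : ∀ l, (x l) ^ 2 = (Pi.single j 1 : Fin N → ℝ) l * x l - (1 / (N : ℝ)) * x l := by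
        intro l
        simp only [hx, Pi.sub_apply, Pi.smul_apply, smul_eq_mul]
        ring
      simp_rw [h', Finset.sum_sub_distrib, ← Finset.mul_sum]
      simp [Pi.single_apply]
    rw [h, hsum]
    simp [hx]
  rw [← hval, ← Real.sqrt_sq_eq_abs]
  calc Real.sqrt ((L ^ k).mulVec x i ^ 2)
      ≤ Real.sqrt (∑ l, ((L ^ k).mulVec x l) ^ 2) :=
        Real.sqrt_le_sqrt (Finset.single_le_sum (f := fun l => ((L ^ k).mulVec x l) ^ 2)
          (fun l _ => sq_nonneg _) (Finset.mem_univ i))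
    _ ≤ r ^ k * Real.sqrt (∑ l, (x l) ^ 2) :=
        (sqrt_sum_sq_pow_mulVec_le hsymm hones hr0 hcontract hsum k).2
    _ ≤ r ^ k := mul_le_of_le_one_right (pow_nonneg hr0 k) (Real.sqrt_le_one.mpr hnorm)

/-- if `L` is symmetric, `L 𝟙 = 𝟙`, `‖L x‖₂ ≤ r ‖x‖₂` for every `x ⟂ 𝟙`
with `0 ≤ r < 1`, and `k ≥ 1` satisfies `N r^k < 1`, then for all `i, j`:
`(L^k)_{ij} ≥ 1/N − r^k > 0` and `|1/(N (L^k)_{ij}) − 1| ≤ N r^k / (1 − N r^k)`. -/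
theorem power_entry_positive_and_ratio_bound {N : ℕ}
    (L : Matrix (Fin N) (Fin N) ℝ) (hsymm : L.IsSymm)
    (hones : L.mulVec (fun _ => 1) = fun _ => 1)
    (r : ℝ) (hr0 : 0 ≤ r) (hr1 : r < 1)
    (hcontract : ∀ x : Fin N → ℝ, ∑ i, x i * 1 = 0 →
      Real.sqrt (∑ i, (L.mulVec x i) ^ 2) ≤ r * Real.sqrt (∑ i, (x i) ^ 2))
    (k : ℕ) (hk : 1 ≤ k) (hsmall : (N : ℝ) * r ^ k < 1) :
    ∀ i j : Fin N,
      (1 / (N : ℝ) - r ^ k ≤ (L ^ k) i j) ∧ (0 < 1 / (N : ℝ) - r ^ k) ∧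
      |1 / ((N : ℝ) * (L ^ k) i j) - 1| ≤ (N : ℝ) * r ^ k / (1 - (N : ℝ) * r ^ k) := by
  intro i j
  have hN : (0 : ℝ) < N := by exact_mod_cast i.pos
  have habs := abs_pow_apply_sub_le hsymm hones hr0
    (fun x hx => hcontract x (by simpa using hx)) k i j
  have hlow : 1 / (N : ℝ) - r ^ k ≤ (L ^ k) i j := by linarith [(abs_le.mp habs).1]
  have hpos : 0 < 1 / (N : ℝ) - r ^ k := by
    rw [sub_pos, lt_div_iff₀ hN]
    linarith
  refine ⟨hlow, hpos, ?_⟩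
  have ha : 0 < (L ^ k) i j := hpos.trans_le hlow
  have hsplit : 1 / ((N : ℝ) * (L ^ k) i j) - 1
      = -(N * ((L ^ k) i j - 1 / N)) / (N * (L ^ k) i j) := by
    field_simp
    ring
  have hden : 1 - (N : ℝ) * r ^ k ≤ N * (L ^ k) i j := by
    have h := mul_le_mul_of_nonneg_left hlow hN.le
    rwa [mul_sub, mul_one_div_cancel hN.ne'] at h
  rw [hsplit, abs_div, abs_neg, abs_mul, abs_of_pos hN, abs_of_pos (mul_pos hN ha)]
  exact div_le_div₀ (by positivity) (mul_le_mul_of_nonneg_left habs hN.le) (by linarith) hden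
end

section
/- Let A ∈ ℝ^{n×n} be invertible, let C_i ∈ ℝ^{m_i×n} (i = 1, …, N) satisfy collective observability (the only x ∈ ℝ^n with C_i A^k x = 0 for all i and all integers k ≥ 0 is x = 0), let Q ∈ ℝ^{n×n} and R_i ∈ ℝ^{m_i×m_i} be positive definite, and let L = [l_ij] be an N×N matrix that is symmetric, has nonnegative entries, positive diagonal entries, row sums equal to 1, and is irreducible (for all i, j there exists m ≥ 1 with (L^m)_{ij} > 0). Then the harmonic-coupled Riccati equation P_i = A(∑_{j=1}^N l_ij P_j⁻¹ + C_iᵀ R_i⁻¹ C_i)⁻¹ Aᵀ + Q (i = 1, …, N) has a unique solution among families of positive definite matrices (P_1, …, P_N), and for any positive definite initial values P_{1,0}, …, P_{N,0}, the iterates of the recursion P_{i,k+1} = A(∑_{j=1}^N l_ij P_{j,k}⁻¹ + C_iᵀ R_i⁻¹ C_i)⁻¹ Aᵀ + Q converge to P_i for every i. -/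
open Matrix Filter

section
open scoped MatrixOrder

variable {n N : ℕ}

namespace Matrix

lemma le_iff_dotProduct_mulVec_le {X Y : Matrix (Fin n) (Fin n) ℝ}
    (hX : X.IsHermitian) (hY : Y.IsHermitian) :
    X ≤ Y ↔ ∀ x : Fin n → ℝ, x ⬝ᵥ X *ᵥ x ≤ x ⬝ᵥ Y *ᵥ x := by
  rw [Matrix.le_iff, posSemidef_iff_dotProduct_mulVec]
  simp only [hY.sub hX, true_and, star_trivial, sub_mulVec, dotProduct_sub, sub_nonneg]

lemma conj_transpose_mono {X Y : Matrix (Fin n) (Fin n) ℝ} (h : X ≤ Y)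
    (B : Matrix (Fin n) (Fin n) ℝ) : B * X * Bᵀ ≤ B * Y * Bᵀ := by
  rw [Matrix.le_iff] at h ⊢
  simpa [Matrix.mul_sub, Matrix.sub_mul] using h.mul_mul_conjTranspose_same B

lemma PosDef.of_le {X Y : Matrix (Fin n) (Fin n) ℝ} (hX : X.PosDef) (h : X ≤ Y) :
    Y.PosDef := by
  simpa using hX.add_posSemidef (Matrix.le_iff.1 h)

lemma PosDef.inv_le_inv {X Y : Matrix (Fin n) (Fin n) ℝ} (hX : X.PosDef) (h : X ≤ Y) :
    Y⁻¹ ≤ X⁻¹ := by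
  have hY := hX.of_le h
  have hXd := (isUnit_iff_isUnit_det X).1 hX.isUnit
  have hYd := (isUnit_iff_isUnit_det Y).1 hY.isUnit
  rw [Matrix.le_iff] at h ⊢
  have key : X⁻¹ - Y⁻¹ = Y⁻¹ * ((Y - X) + (Y - X) * X⁻¹ * (Y - X)ᴴ) * (Y⁻¹)ᴴ := by
    rw [h.isHermitian.eq, hY.inv.isHermitian.eq]
    have : (Y - X) + (Y - X) * X⁻¹ * (Y - X) = Y * X⁻¹ * Y - Y := by
      simp only [Matrix.sub_mul, Matrix.mul_sub, Matrix.mul_assoc, nonsing_inv_mul X hXd,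
        mul_nonsing_inv_cancel_left X _ hXd, Matrix.mul_one]
      abel
    rw [this]
    simp only [Matrix.sub_mul, Matrix.mul_sub, Matrix.mul_assoc, mul_nonsing_inv Y hYd,
        nonsing_inv_mul_cancel_left Y _ hYd, Matrix.mul_one]
  rw [key]
  exact (h.add (hX.inv.posSemidef.mul_mul_conjTranspose_same _)).mul_mul_conjTranspose_same _

lemma inv_smul_of_ne_zero {c : ℝ} (hc : c ≠ 0) (X : Matrix (Fin n) (Fin n) ℝ)
    (hX : IsUnit X.det) : (c • X)⁻¹ = c⁻¹ • X⁻¹ := by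
  simpa [Units.smul_def] using inv_smul' X (Units.mk0 c hc) hX

lemma exists_le_smul_one (X : Matrix (Fin n) (Fin n) ℝ) (hX : X.IsHermitian) :
    ∃ t : ℝ, 0 < t ∧ X ≤ t • (1 : Matrix (Fin n) (Fin n) ℝ) := by
  obtain ⟨b, hb⟩ := (X.finite_real_spectrum).bddAbove
  refine ⟨max b 1, by positivity, ?_⟩
  rw [← Algebra.algebraMap_eq_smul_one]
  exact le_algebraMap_of_spectrum_le (ha := hX) fun x hx => (hb hx).trans (le_max_left _ _)

lemma PosDef.exists_le_smul {Y : Matrix (Fin n) (Fin n) ℝ} (hY : Y.PosDef)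
    {X : Matrix (Fin n) (Fin n) ℝ} (hX : X.IsHermitian) :
    ∃ t : ℝ, 0 < t ∧ X ≤ t • Y := by
  obtain ⟨s, hs, h⟩ := exists_le_smul_one X hX
  obtain ⟨t, ht, h'⟩ := exists_le_smul_one Y⁻¹ hY.inv.isHermitian
  refine ⟨s * t, by positivity, h.trans ?_⟩
  have h1 := hY.inv.inv_le_inv h'
  rw [inv_smul_of_ne_zero ht.ne' _ (by simp), inv_one,
    nonsing_inv_nonsing_inv _ ((isUnit_iff_isUnit_det Y).1 hY.isUnit)] at h1
  have h2 := smul_le_smul_of_nonneg_left h1 (mul_pos hs ht).le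
  rwa [smul_smul, mul_assoc, mul_inv_cancel₀ ht.ne', mul_one] at h2

lemma IsHermitian.apply_eq_polarization {X : Matrix (Fin n) (Fin n) ℝ} (hX : X.IsHermitian)
    (i j : Fin n) : X i j = ((Pi.single i 1 + Pi.single j 1) ⬝ᵥ X *ᵥ (Pi.single i 1 + Pi.single j 1)
      - Pi.single i 1 ⬝ᵥ X *ᵥ Pi.single i 1 - Pi.single j 1 ⬝ᵥ X *ᵥ Pi.single j 1) / 2 := by
  have h : X j i = X i j := by simpa using hX.apply i j
  simp [mulVec_add, h]
  ring

lemma tendsto_of_forall_dotProduct_mulVec {M : ℕ → Matrix (Fin n) (Fin n) ℝ}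
    {X : Matrix (Fin n) (Fin n) ℝ} (hM : ∀ k, (M k).IsHermitian) (hX : X.IsHermitian)
    (h : ∀ x : Fin n → ℝ, Tendsto (fun k => x ⬝ᵥ M k *ᵥ x) atTop (nhds (x ⬝ᵥ X *ᵥ x))) :
    Tendsto M atTop (nhds X) := by
  refine tendsto_pi_nhds.2 fun i => tendsto_pi_nhds.2 fun j => ?_
  rw [hX.apply_eq_polarization i j]
  simp_rw [fun k => (hM k).apply_eq_polarization i j]
  exact (((h _).sub (h _)).sub (h _)).div_const 2

lemma tendsto_dotProduct_mulVec {M : ℕ → Matrix (Fin n) (Fin n) ℝ}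
    {X : Matrix (Fin n) (Fin n) ℝ} (h : Tendsto M atTop (nhds X)) (x : Fin n → ℝ) :
    Tendsto (fun k => x ⬝ᵥ M k *ᵥ x) atTop (nhds (x ⬝ᵥ X *ᵥ x)) := by
  have : Continuous fun Y : Matrix (Fin n) (Fin n) ℝ => x ⬝ᵥ Y *ᵥ x := by fun_prop
  exact (this.tendsto X).comp h

lemma exists_tendsto_of_antitone {M : ℕ → Matrix (Fin n) (Fin n) ℝ}
    (hM : ∀ k, (M k).PosSemidef) (hanti : Antitone M) :
    ∃ X : Matrix (Fin n) (Fin n) ℝ, X.PosSemidef ∧ Tendsto M atTop (nhds X) := by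
  have hq (x : Fin n → ℝ) : ∃ l, Tendsto (fun k => x ⬝ᵥ M k *ᵥ x) atTop (nhds l) := by
    refine ⟨_, tendsto_atTop_ciInf (fun a b hab => ?_) ⟨0, ?_⟩⟩
    · exact (le_iff_dotProduct_mulVec_le (hM b).isHermitian (hM a).isHermitian).1 (hanti hab) x
    · rintro _ ⟨k, rfl⟩
      simpa using (hM k).dotProduct_mulVec_nonneg x
  choose q hq using hq
  obtain ⟨X, hX⟩ : ∃ X, Tendsto M atTop (nhds X) := by
    refine ⟨fun i j => (q (Pi.single i 1 + Pi.single j 1) - q (Pi.single i 1)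
      - q (Pi.single j 1)) / 2, tendsto_pi_nhds.2 fun i => tendsto_pi_nhds.2 fun j => ?_⟩
    simp_rw [fun k => (hM k).isHermitian.apply_eq_polarization i j]
    exact (((hq _).sub (hq _)).sub (hq _)).div_const 2
  refine ⟨X, .of_dotProduct_mulVec_nonneg ?_ fun x => ?_, hX⟩
  · have h1 : Tendsto (fun k => (M k)ᴴ) atTop (nhds Xᴴ) :=
      ((continuous_id.matrix_conjTranspose).tendsto X).comp hX
    simp_rw [fun k => (hM k).isHermitian.eq] at h1
    exact tendsto_nhds_unique h1 hX
  · refine ge_of_tendsto' (tendsto_dotProduct_mulVec hX x) fun k => ?_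
    simpa using (hM k).dotProduct_mulVec_nonneg x

lemma tendsto_inv {M : ℕ → Matrix (Fin n) (Fin n) ℝ} {X : Matrix (Fin n) (Fin n) ℝ}
    (h : Tendsto M atTop (nhds X)) (hX : X.PosDef) :
    Tendsto (fun k => (M k)⁻¹) atTop (nhds X⁻¹) := by
  refine Tendsto.comp (g := Inv.inv) (continuousAt_matrix_inv X ?_) h
  rw [Ring.inverse_eq_inv']
  exact continuousAt_inv₀ hX.det_pos.ne'

end Matrix

/-- The information matrices `∑ j, L i j • W j + S i`. -/
def fusedInformation (L : Matrix (Fin N) (Fin N) ℝ) (S W : Fin N → Matrix (Fin n) (Fin n) ℝ)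
    (i : Fin N) : Matrix (Fin n) (Fin n) ℝ :=
  ∑ j, L i j • W j + S i

/-- One step of the harmonic-coupled Riccati recursion. -/
noncomputable def harmonicRiccati (A Q : Matrix (Fin n) (Fin n) ℝ) (L : Matrix (Fin N) (Fin N) ℝ)
    (S P : Fin N → Matrix (Fin n) (Fin n) ℝ) (i : Fin N) : Matrix (Fin n) (Fin n) ℝ :=
  A * (fusedInformation L S (fun j => (P j)⁻¹) i)⁻¹ * Aᵀ + Q

section Riccati

variable {A Q : Matrix (Fin n) (Fin n) ℝ} {L : Matrix (Fin N) (Fin N) ℝ}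
  {S : Fin N → Matrix (Fin n) (Fin n) ℝ}

lemma fusedInformation_posDef (hS : ∀ i, (S i).PosSemidef) (hL : ∀ i j, 0 ≤ L i j)
    (hd : ∀ i, 0 < L i i) {W : Fin N → Matrix (Fin n) (Fin n) ℝ} (hW : ∀ j, (W j).PosDef)
    (i : Fin N) : (fusedInformation L S W i).PosDef := by
  refine PosDef.add_posSemidef ?_ (hS i)
  rw [← Finset.add_sum_erase _ _ (Finset.mem_univ i)]
  exact ((hW i).smul (hd i)).add_posSemidef
    (posSemidef_sum _ fun j _ => (hW j).posSemidef.smul (hL i j))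

lemma fusedInformation_mono (hL : ∀ i j, 0 ≤ L i j) {W W' : Fin N → Matrix (Fin n) (Fin n) ℝ}
    (h : ∀ j, W j ≤ W' j) (i : Fin N) : fusedInformation L S W i ≤ fusedInformation L S W' i :=
  add_le_add_left (Finset.sum_le_sum fun j _ => smul_le_smul_of_nonneg_left (h j) (hL i j)) _

lemma le_harmonicRiccati (hS : ∀ i, (S i).PosSemidef) (hL : ∀ i j, 0 ≤ L i j)
    (hd : ∀ i, 0 < L i i) {P : Fin N → Matrix (Fin n) (Fin n) ℝ} (hP : ∀ j, (P j).PosDef)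
    (i : Fin N) : Q ≤ harmonicRiccati A Q L S P i := by
  rw [Matrix.le_iff, harmonicRiccati, add_sub_cancel_right]
  simpa using (fusedInformation_posDef hS hL hd
    (fun j => (hP j).inv) i).inv.posSemidef.mul_mul_conjTranspose_same A

lemma harmonicRiccati_posDef (hQ : Q.PosDef) (hS : ∀ i, (S i).PosSemidef)
    (hL : ∀ i j, 0 ≤ L i j) (hd : ∀ i, 0 < L i i) {P : Fin N → Matrix (Fin n) (Fin n) ℝ}
    (hP : ∀ j, (P j).PosDef) (i : Fin N) : (harmonicRiccati A Q L S P i).PosDef :=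
  hQ.of_le (le_harmonicRiccati hS hL hd hP i)

lemma harmonicRiccati_mono (hS : ∀ i, (S i).PosSemidef)
    (hL : ∀ i j, 0 ≤ L i j) (hd : ∀ i, 0 < L i i) {P P' : Fin N → Matrix (Fin n) (Fin n) ℝ}
    (hP : ∀ j, (P j).PosDef) (h : ∀ j, P j ≤ P' j) (i : Fin N) :
    harmonicRiccati A Q L S P i ≤ harmonicRiccati A Q L S P' i := by
  refine add_le_add_left (conj_transpose_mono (PosDef.inv_le_inv ?_ ?_) A) Q
  · exact fusedInformation_posDef hS hL hd (fun j => ((hP j).of_le (h j)).inv) i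
  · exact fusedInformation_mono hL (fun j => (hP j).inv_le_inv (h j)) i

lemma fusedInformation_inv_smul {c : ℝ} (hc : 0 < c) {P : Fin N → Matrix (Fin n) (Fin n) ℝ}
    (hP : ∀ j, (P j).PosDef) (i : Fin N) :
    fusedInformation L S (fun j => (c • P j)⁻¹) i =
      c⁻¹ • fusedInformation L S (fun j => (P j)⁻¹) i + (1 - c⁻¹) • S i := by
  have h (j : Fin N) : (c • P j)⁻¹ = c⁻¹ • (P j)⁻¹ :=
    inv_smul_of_ne_zero hc.ne' _ (hP j).det_pos.ne'.isUnit
  simp only [fusedInformation, h, smul_add, Finset.smul_sum, sub_smul, one_smul]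
  simp only [smul_comm c⁻¹]
  abel

lemma smul_harmonicRiccati_eq {c : ℝ} (hc : 0 < c) (hS : ∀ i, (S i).PosSemidef)
    (hL : ∀ i j, 0 ≤ L i j) (hd : ∀ i, 0 < L i i) {P : Fin N → Matrix (Fin n) (Fin n) ℝ}
    (hP : ∀ j, (P j).PosDef) (i : Fin N) :
    c • harmonicRiccati A Q L S P i + (1 - c) • Q =
      A * (c⁻¹ • fusedInformation L S (fun j => (P j)⁻¹) i)⁻¹ * Aᵀ + Q := by
  have hM := fusedInformation_posDef hS hL hd (fun j => (hP j).inv) i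
  rw [inv_smul_of_ne_zero (inv_pos.2 hc).ne' _ hM.det_pos.ne'.isUnit, inv_inv, harmonicRiccati]
  simp only [smul_add, sub_smul, one_smul, Matrix.mul_smul, Matrix.smul_mul]
  abel

/-- Subhomogeneity of the Riccati map under expansions. -/
lemma harmonicRiccati_smul_le {c : ℝ} (hc : 1 ≤ c) (hS : ∀ i, (S i).PosSemidef)
    (hL : ∀ i j, 0 ≤ L i j) (hd : ∀ i, 0 < L i i) {P : Fin N → Matrix (Fin n) (Fin n) ℝ}
    (hP : ∀ j, (P j).PosDef) (i : Fin N) :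
    harmonicRiccati A Q L S (fun j => c • P j) i ≤
      c • harmonicRiccati A Q L S P i + (1 - c) • Q := by
  have hc0 : 0 < c := by linarith
  have hM := fusedInformation_posDef hS hL hd (fun j => (hP j).inv) i
  rw [smul_harmonicRiccati_eq hc0 hS hL hd hP, harmonicRiccati, fusedInformation_inv_smul hc0 hP]
  refine add_le_add_left (conj_transpose_mono (PosDef.inv_le_inv (hM.smul (inv_pos.2 hc0)) ?_) A) Q
  rw [Matrix.le_iff, add_sub_cancel_left]
  exact (hS i).smul (sub_nonneg.2 (inv_le_one_of_one_le₀ hc))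

/-- Superhomogeneity of the Riccati map under contractions. -/
lemma le_harmonicRiccati_smul {c : ℝ} (hc0 : 0 < c) (hc : c ≤ 1) (hS : ∀ i, (S i).PosSemidef)
    (hL : ∀ i j, 0 ≤ L i j) (hd : ∀ i, 0 < L i i) {P : Fin N → Matrix (Fin n) (Fin n) ℝ}
    (hP : ∀ j, (P j).PosDef) (i : Fin N) :
    c • harmonicRiccati A Q L S P i + (1 - c) • Q ≤
      harmonicRiccati A Q L S (fun j => c • P j) i := by
  have hM := fusedInformation_posDef hS hL hd (fun j => (hP j).inv) i
  have hM' := fusedInformation_posDef hS hL hd (fun j => ((hP j).smul hc0).inv) i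
  rw [smul_harmonicRiccati_eq hc0 hS hL hd hP, harmonicRiccati]
  refine add_le_add_left (conj_transpose_mono (PosDef.inv_le_inv hM' ?_) A) Q
  rw [fusedInformation_inv_smul hc0 hP, Matrix.le_iff, sub_add_cancel_left, ← neg_smul, neg_sub]
  exact (hS i).smul (sub_nonneg.2 ((one_le_inv₀ hc0).2 hc))

/-- From any positive definite initial family, the recursion converges to any positive definite
fixed point: the multiplicative gap to the fixed point shrinks geometrically. -/
theorem tendsto_of_harmonicRiccati_eq (hQ : Q.PosDef) (hS : ∀ i, (S i).PosSemidef)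
    (hL : ∀ i j, 0 ≤ L i j) (hd : ∀ i, 0 < L i i) {P : Fin N → Matrix (Fin n) (Fin n) ℝ}
    (hP : ∀ j, (P j).PosDef) (hfix : ∀ i, P i = harmonicRiccati A Q L S P i)
    {X : ℕ → Fin N → Matrix (Fin n) (Fin n) ℝ} (hX0 : ∀ i, (X 0 i).PosDef)
    (hX : ∀ k i, X (k + 1) i = harmonicRiccati A Q L S (X k) i) (i : Fin N) :
    Tendsto (fun k => X k i) atTop (nhds (P i)) := by
  have hXpos (k : ℕ) : ∀ i, (X k i).PosDef := by
    induction k with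
    | zero => exact hX0
    | succ k ih => intro i; rw [hX]; exact harmonicRiccati_posDef hQ hS hL hd ih i
  have bound {Y Z : Fin N → Matrix (Fin n) (Fin n) ℝ} (hY : ∀ j, (Y j).PosDef)
      (hZ : ∀ j, (Z j).PosDef) : ∃ t : ℝ, 1 < t ∧ ∀ j, Z j ≤ t • Y j := by
    choose t ht h using fun j => (hY j).exists_le_smul (hZ j).isHermitian
    refine ⟨∑ j, t j + 2, ?_, fun j => (h j).trans ?_⟩
    · linarith [Finset.sum_nonneg fun j (_ : j ∈ Finset.univ) => (ht j).le]
    · rw [Matrix.le_iff, ← sub_smul]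
      refine (hY j).posSemidef.smul ?_
      linarith [Finset.single_le_sum (fun j _ => (ht j).le) (Finset.mem_univ j)]
  obtain ⟨s, hs, hsQ⟩ := bound (fun _ => hQ) hP
  obtain ⟨u, hu, hXu⟩ := bound hP hX0
  obtain ⟨v, hv, hXv⟩ := bound hX0 hP
  have hs0 : 0 < s := by linarith
  have hv0 : 0 < v := by linarith
  set r := 1 - s⁻¹ with hr
  have hs1 : s⁻¹ < 1 := inv_lt_one_of_one_lt₀ hs
  have hr0 : 0 ≤ r := by linarith
  have hr1 : r < 1 := by linarith [inv_pos.2 hs0]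
  have hQP (j : Fin N) : ((1 - r) • P j) ≤ Q := by
    have := smul_le_smul_of_nonneg_left (hsQ j) (inv_pos.2 hs0).le
    rwa [smul_smul, inv_mul_cancel₀ hs0.ne', one_smul, ← sub_sub_self 1 s⁻¹] at this
  have upper (k : ℕ) : ∀ j, X k j ≤ (1 + (u - 1) * r ^ k) • P j := by
    induction k with
    | zero => simpa using hXu
    | succ k ih =>
      intro j
      have hb : 0 ≤ (u - 1) * r ^ k := mul_nonneg (by linarith) (pow_nonneg hr0 k)
      rw [hX]
      refine (harmonicRiccati_mono hS hL hd (hXpos k) ih j).trans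
        ((harmonicRiccati_smul_le (by linarith) hS hL hd hP j).trans ?_)
      rw [← hfix, pow_succ]
      have := smul_le_smul_of_nonneg_left (hQP j) hb
      rw [← sub_nonneg] at this ⊢
      convert this using 1
      module
  have hv1 : v⁻¹ < 1 := inv_lt_one_of_one_lt₀ hv
  have lower (k : ℕ) : ∀ j, (1 - (1 - v⁻¹) * r ^ k) • P j ≤ X k j := by
    induction k with
    | zero =>
      intro j
      have := smul_le_smul_of_nonneg_left (hXv j) (inv_pos.2 hv0).le
      rw [smul_smul, inv_mul_cancel₀ hv0.ne', one_smul] at this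
      simpa using this
    | succ k ih =>
      intro j
      have hb : 0 ≤ (1 - v⁻¹) * r ^ k := mul_nonneg (by linarith) (pow_nonneg hr0 k)
      have hb1 : (1 - v⁻¹) * r ^ k < 1 := by
        refine (mul_le_of_le_one_right (by linarith) (pow_le_one₀ hr0 hr1.le)).trans_lt ?_
        linarith [inv_pos.2 hv0]
      have hb2 : 0 < 1 - (1 - v⁻¹) * r ^ k := by linarith
      rw [hX]
      refine le_trans ?_ ((le_harmonicRiccati_smul hb2 (by linarith) hS hL hd hP j).trans
        (harmonicRiccati_mono hS hL hd (fun j => (hP j).smul hb2) ih j))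
      rw [← hfix, pow_succ]
      have := smul_le_smul_of_nonneg_left (hQP j) hb
      rw [← sub_nonneg] at this ⊢
      convert this using 1
      module
  have hpow := tendsto_pow_atTop_nhds_zero_of_lt_one hr0 hr1
  refine tendsto_of_forall_dotProduct_mulVec (fun k => (hXpos k i).isHermitian)
    (hP i).isHermitian fun x => ?_
  have lim (c : ℝ) : Tendsto (fun k => (1 + c * r ^ k) * (x ⬝ᵥ P i *ᵥ x)) atTop
      (nhds (x ⬝ᵥ P i *ᵥ x)) := by
    simpa using ((hpow.const_mul c).const_add 1).mul_const (x ⬝ᵥ P i *ᵥ x)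
  refine tendsto_of_tendsto_of_tendsto_of_le_of_le (lim (-(1 - v⁻¹))) (lim (u - 1))
    (fun k => ?_) (fun k => ?_)
  · have := (le_iff_dotProduct_mulVec_le ((hP i).isHermitian.smul (k := 1 - (1 - v⁻¹) * r ^ k) rfl)
      (hXpos k i).isHermitian).1 (lower k i) x
    rwa [smul_mulVec, dotProduct_smul, smul_eq_mul, sub_eq_add_neg, ← neg_mul] at this
  · have := (le_iff_dotProduct_mulVec_le (hXpos k i).isHermitian
      ((hP i).isHermitian.smul (k := 1 + (u - 1) * r ^ k) rfl)).1 (upper k i) x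
    simpa [smul_mulVec] using this

/-- Kernels linked along an irreducible graph and shrunk by the dynamics vanish under collective
observability. -/
lemma eq_bot_of_forall_link (hA : IsUnit A.det) (hL : ∀ i j, 0 ≤ L i j) (hd : ∀ i, 0 < L i i)
    (hirr : ∀ i j, ∃ k : ℕ, 1 ≤ k ∧ 0 < (L ^ k) i j)
    (hobs : ∀ x : Fin n → ℝ, (∀ i (k : ℕ), S i *ᵥ (A ^ k *ᵥ x) = 0) → x = 0)
    (V : Fin N → Submodule ℝ (Fin n → ℝ))
    (hV : ∀ i j, 0 < L i j → ∀ x, A *ᵥ x ∈ V i → x ∈ V j)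
    (hVS : ∀ i x, A *ᵥ x ∈ V i → S i *ᵥ x = 0) (i : Fin N) : V i = ⊥ := by
  have hinv (i : Fin N) (x) (hx : x ∈ V i) : A *ᵥ x ∈ V i := by
    let e : (Fin n → ℝ) ≃ₗ[ℝ] (Fin n → ℝ) := A.toLinearEquiv' (A.invertibleOfIsUnitDet hA)
    have he (x) : e x = A *ᵥ x := rfl
    have hle : (V i).map (e.symm : (Fin n → ℝ) →ₗ[ℝ] (Fin n → ℝ)) ≤ V i := by
      rintro _ ⟨y, hy, rfl⟩
      refine hV i i (hd i) _ ?_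
      rw [← he]
      simpa using hy
    have heq := Submodule.eq_of_le_of_finrank_eq hle (e.symm.finrank_map_eq (V i))
    rw [← heq] at hx
    obtain ⟨y, hy, rfl⟩ := hx
    rw [← he]
    simpa using hy
  have hLk (k : ℕ) : ∀ i j, 0 ≤ (L ^ k) i j := by
    induction k with
    | zero => intro i j; rw [pow_zero, Matrix.one_apply]; positivity
    | succ k ih =>
      intro i j
      rw [pow_succ, Matrix.mul_apply]
      exact Finset.sum_nonneg fun l _ => mul_nonneg (ih i l) (hL l j)
  have hpath (k : ℕ) : ∀ i j, 0 < (L ^ k) i j → V i ≤ V j := by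
    induction k with
    | zero =>
      intro i j h
      obtain rfl : i = j := by
        by_contra hij
        simp [Matrix.one_apply_ne hij] at h
      exact le_rfl
    | succ k ih =>
      intro i j h
      rw [pow_succ, Matrix.mul_apply] at h
      obtain ⟨l, -, hl⟩ := Finset.exists_lt_of_sum_lt
        (f := fun _ : Fin N => (0 : ℝ)) (by simpa using h)
      have h1 : 0 < L l j := (hL l j).lt_of_ne' fun h0 => by simp [h0] at hl
      have h2 : 0 < (L ^ k) i l := (hLk k i l).lt_of_ne' fun h0 => by simp [h0] at hl
      exact (ih i l h2).trans fun x hx => hV l j h1 x (hinv l x hx)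
  rw [Submodule.eq_bot_iff]
  intro x hx
  refine hobs x fun j k => hVS j _ (hinv j _ ?_)
  obtain ⟨p, -, hp⟩ := hirr i j
  refine hpath p i j hp ?_
  induction k with
  | zero => simpa using hx
  | succ k ih =>
    rw [pow_succ', ← mulVec_mulVec]
    exact hinv i _ ih

/-- Existence of a positive definite fixed point: the recursion started at `Q` is increasing, and
collective observability bounds it by keeping the limit of its inverses nonsingular. -/
theorem exists_harmonicRiccati_eq (hA : IsUnit A.det) (hQ : Q.PosDef) (hS : ∀ i, (S i).PosSemidef)
    (hL : ∀ i j, 0 ≤ L i j) (hd : ∀ i, 0 < L i i)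
    (hirr : ∀ i j, ∃ k : ℕ, 1 ≤ k ∧ 0 < (L ^ k) i j)
    (hobs : ∀ x : Fin n → ℝ, (∀ i (k : ℕ), S i *ᵥ (A ^ k *ᵥ x) = 0) → x = 0) :
    ∃ P : Fin N → Matrix (Fin n) (Fin n) ℝ, (∀ i, (P i).PosDef) ∧
      ∀ i, P i = harmonicRiccati A Q L S P i := by
  let X : ℕ → Fin N → Matrix (Fin n) (Fin n) ℝ :=
    fun k => (harmonicRiccati A Q L S)^[k] fun _ => Q
  have hX (k : ℕ) : X (k + 1) = harmonicRiccati A Q L S (X k) :=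
    Function.iterate_succ_apply' _ _ _
  have hXpos (k : ℕ) : ∀ i, (X k i).PosDef := by
    induction k with
    | zero => exact fun _ => hQ
    | succ k ih => rw [hX]; exact harmonicRiccati_posDef hQ hS hL hd ih
  have hXmono : Monotone X := by
    refine monotone_nat_of_le_succ fun k => ?_
    induction k with
    | zero => rw [hX]; exact le_harmonicRiccati hS hL hd (hXpos 0)
    | succ k ih =>
      rw [hX (k + 1)]
      nth_rewrite 1 [hX k]
      exact harmonicRiccati_mono hS hL hd (hXpos k) ih
  have hanti (i : Fin N) : Antitone fun k => (X k i)⁻¹ :=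
    fun a b hab => (hXpos a i).inv_le_inv (hXmono hab i)
  choose W hW hlim using fun i =>
    exists_tendsto_of_antitone (fun k => (hXpos k i).inv.posSemidef) (hanti i)
  have hfus (i : Fin N) : Tendsto (fun k => fusedInformation L S (fun j => (X k j)⁻¹) i) atTop
      (nhds (fusedInformation L S W i)) :=
    (tendsto_finsetSum _ fun j _ => (hlim j).const_smul (L i j)).add_const _
  have hMpos (k : ℕ) (i : Fin N) : (fusedInformation L S (fun j => (X k j)⁻¹) i).PosDef :=
    fusedInformation_posDef hS hL hd (fun j => (hXpos k j).inv) i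
  have hcomp (i : Fin N) : ∃ c : ℝ, 0 < c ∧ ∀ k,
      fusedInformation L S (fun j => (X k j)⁻¹) i ≤ c • (Aᵀ * (X (k + 1) i)⁻¹ * A) := by
    have hAinj : Function.Injective (A.vecMul) :=
      vecMul_injective_iff_isUnit.2 ((isUnit_iff_isUnit_det A).2 hA)
    have hApos {M : Matrix (Fin n) (Fin n) ℝ} (hM : M.PosDef) : (A * M⁻¹ * Aᵀ).PosDef := by
      simpa using hM.inv.mul_mul_conjTranspose_same hAinj
    obtain ⟨c, hc, h⟩ := (hApos (hMpos 0 i)).exists_le_smul hQ.isHermitian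
    have hc1 : 0 < 1 + c := by linarith
    refine ⟨1 + c, hc1, fun k => ?_⟩
    set M := fusedInformation L S (fun j => (X k j)⁻¹) i with hM
    have hMp : M.PosDef := hMpos k i
    have hM0 : M ≤ fusedInformation L S (fun j => (X 0 j)⁻¹) i :=
      fusedInformation_mono hL (fun j => hanti j (Nat.zero_le k)) i
    have hle : X (k + 1) i ≤ (1 + c) • (A * M⁻¹ * Aᵀ) := by
      rw [hX, harmonicRiccati, ← hM, add_smul, one_smul]
      exact add_le_add_right (h.trans (smul_le_smul_of_nonneg_left
        (conj_transpose_mono (hMp.inv_le_inv hM0) A) hc.le)) _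
    have h1 := (hXpos (k + 1) i).inv_le_inv hle
    rw [inv_smul_of_ne_zero hc1.ne' _ (hApos hMp).det_pos.ne'.isUnit] at h1
    have h2 := smul_le_smul_of_nonneg_left (conj_transpose_mono h1 Aᵀ) hc1.le
    have hAt : IsUnit Aᵀ.det := by rwa [det_transpose]
    simpa [Matrix.mul_inv_rev, Matrix.mul_assoc, hc1.ne', smul_smul,
      nonsing_inv_nonsing_inv _ hMp.det_pos.ne'.isUnit,
      mul_nonsing_inv_cancel_left _ _ hAt, nonsing_inv_mul _ hA] using h2
  have hWpos (i : Fin N) : (W i).PosDef := by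
    have hker (i : Fin N) (x : Fin n → ℝ) (hx : A *ᵥ x ∈ LinearMap.ker (W i).mulVecLin) :
        (∀ j, 0 < L i j → W j *ᵥ x = 0) ∧ S i *ᵥ x = 0 := by
      obtain ⟨c, hc, h⟩ := hcomp i
      have hx0 : W i *ᵥ (A *ᵥ x) = 0 := by simpa using hx
      have hWx (j : Fin N) : 0 ≤ x ⬝ᵥ W j *ᵥ x := by
        simpa using (hW j).dotProduct_mulVec_nonneg x
      have hSx : 0 ≤ x ⬝ᵥ S i *ᵥ x := by simpa using (hS i).dotProduct_mulVec_nonneg x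
      have hlhs := tendsto_dotProduct_mulVec (hfus i) x
      have hrhs := (tendsto_dotProduct_mulVec ((tendsto_add_atTop_iff_nat 1).2 (hlim i))
        (A *ᵥ x)).const_mul c
      have hle : x ⬝ᵥ fusedInformation L S W i *ᵥ x ≤ 0 := by
        refine (le_of_tendsto_of_tendsto' hlhs hrhs fun k => ?_).trans_eq (by simp [hx0])
        have hH : (Aᵀ * (X (k + 1) i)⁻¹ * A).IsHermitian := by
          simpa using isHermitian_conjTranspose_mul_mul A (hXpos (k + 1) i).inv.isHermitian
        have := (le_iff_dotProduct_mulVec_le (hMpos k i).isHermitian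
          (hH.smul (k := c) rfl)).1 (h k) x
        rwa [smul_mulVec, dotProduct_smul, smul_eq_mul, ← mulVec_mulVec, ← mulVec_mulVec,
          dotProduct_mulVec x Aᵀ, vecMul_transpose] at this
      simp only [fusedInformation, add_mulVec, sum_mulVec, smul_mulVec, dotProduct_add,
        dotProduct_sum, dotProduct_smul, smul_eq_mul] at hle
      have hsum := Finset.sum_nonneg fun j (_ : j ∈ Finset.univ) => mul_nonneg (hL i j) (hWx j)
      have hsum0 : ∑ j, L i j * (x ⬝ᵥ W j *ᵥ x) = 0 := by linarith
      rw [Finset.sum_eq_zero_iff_of_nonneg fun j _ => mul_nonneg (hL i j) (hWx j)] at hsum0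
      refine ⟨fun j hj => ?_, ?_⟩
      · refine ((hW j).dotProduct_mulVec_zero_iff x).1 ?_
        simpa [hj.ne'] using hsum0 j (Finset.mem_univ j)
      · refine ((hS i).dotProduct_mulVec_zero_iff x).1 ?_
        rw [star_trivial]
        linarith
    have hbot := eq_bot_of_forall_link hA hL hd hirr hobs (fun i => LinearMap.ker (W i).mulVecLin)
      (fun i j hij x hx => by simpa using (hker i x hx).1 j hij) (fun i x hx => (hker i x hx).2) i
    refine (hW i).posDef_iff_isUnit.2 (mulVec_injective_iff_isUnit.1 ?_)
    exact LinearMap.ker_eq_bot.1 hbot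
  refine ⟨fun i => (W i)⁻¹, fun i => (hWpos i).inv, fun i => ?_⟩
  have hXlim : Tendsto (fun k => X k i) atTop (nhds (W i)⁻¹) := by
    have := tendsto_inv (hlim i) (hWpos i)
    simpa only [fun k => nonsing_inv_nonsing_inv _ (hXpos k i).det_pos.ne'.isUnit] using this
  have hstep : Tendsto (fun k => X (k + 1) i) atTop
      (nhds (A * (fusedInformation L S W i)⁻¹ * Aᵀ + Q)) := by
    have hcont : Continuous fun Y : Matrix (Fin n) (Fin n) ℝ => A * Y * Aᵀ + Q := by fun_prop
    simp only [hX]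
    exact (hcont.tendsto _).comp
      (tendsto_inv (hfus i) (fusedInformation_posDef hS hL hd hWpos i))
  change (W i)⁻¹ = _
  rw [tendsto_nhds_unique ((tendsto_add_atTop_iff_nat 1).2 hXlim) hstep, harmonicRiccati]
  simp only [fun j => nonsing_inv_nonsing_inv _ (hWpos j).det_pos.ne'.isUnit]

end Riccati
end

/-- under invertibility of `A`, collective observability, positive definite
`Q, R_i`, and a symmetric, entrywise nonnegative, irreducible stochastic weight matrix `L`
with positive diagonal, the harmonic-coupled Riccati equation
`P_i = A(∑_j l_ij P_j⁻¹ + C_iᵀ R_i⁻¹ C_i)⁻¹ Aᵀ + Q` has a unique positive definite solution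
family, and the corresponding recursion converges to it from any positive definite
initial values. -/
theorem hcre_existence_uniqueness_convergence {n N : ℕ}
    (A : Matrix (Fin n) (Fin n) ℝ) (hA : IsUnit A.det)
    (m : Fin N → ℕ)
    (C : ∀ i, Matrix (Fin (m i)) (Fin n) ℝ)
    (hobs : ∀ x : Fin n → ℝ, (∀ i (k : ℕ), (C i).mulVec ((A ^ k).mulVec x) = 0) → x = 0)
    (Q : Matrix (Fin n) (Fin n) ℝ) (hQ : Q.PosDef)
    (R : ∀ i, Matrix (Fin (m i)) (Fin (m i)) ℝ) (hR : ∀ i, (R i).PosDef)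
    (L : Matrix (Fin N) (Fin N) ℝ) (hLsymm : L.IsSymm)
    (hLnonneg : ∀ i j, 0 ≤ L i j) (hLdiag : ∀ i, 0 < L i i)
    (hLrow : ∀ i, ∑ j, L i j = 1)
    (hLirr : ∀ i j, ∃ k : ℕ, 1 ≤ k ∧ 0 < (L ^ k) i j) :
    (∃! P : Fin N → Matrix (Fin n) (Fin n) ℝ,
      (∀ i, (P i).PosDef) ∧
      (∀ i, P i = A * (∑ j, L i j • (P j)⁻¹ + (C i)ᵀ * (R i)⁻¹ * C i)⁻¹ * Aᵀ + Q)) ∧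
    (∀ P : Fin N → Matrix (Fin n) (Fin n) ℝ,
      (∀ i, (P i).PosDef) →
      (∀ i, P i = A * (∑ j, L i j • (P j)⁻¹ + (C i)ᵀ * (R i)⁻¹ * C i)⁻¹ * Aᵀ + Q) →
      ∀ Pseq : ℕ → Fin N → Matrix (Fin n) (Fin n) ℝ,
        (∀ i, (Pseq 0 i).PosDef) →
        (∀ k i, Pseq (k + 1) i =
          A * (∑ j, L i j • (Pseq k j)⁻¹ + (C i)ᵀ * (R i)⁻¹ * C i)⁻¹ * Aᵀ + Q) →
        ∀ i, Tendsto (fun k => Pseq k i) atTop (nhds (P i))) := by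
  have hS (i : Fin N) : ((C i)ᵀ * (R i)⁻¹ * C i).PosSemidef := by
    simpa using (hR i).inv.posSemidef.conjTranspose_mul_mul_same (C i)
  have hobs' (x : Fin n → ℝ)
      (hx : ∀ i (k : ℕ), ((C i)ᵀ * (R i)⁻¹ * C i) *ᵥ (A ^ k *ᵥ x) = 0) : x = 0 := by
    refine hobs x fun i k => ?_
    by_contra hne
    have hpos := (hR i).inv.dotProduct_mulVec_pos hne
    have hzero := congrArg (fun y => (A ^ k *ᵥ x) ⬝ᵥ y) (hx i k)
    simp only [← mulVec_mulVec, dotProduct_zero] at hzero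
    rw [dotProduct_mulVec, vecMul_transpose] at hzero
    simp only [star_trivial, mulVec_mulVec] at hpos hzero
    exact hpos.ne' hzero
  have hconv := fun P hP hfix Pseq h0 hstep => tendsto_of_harmonicRiccati_eq (A := A) (L := L) hQ hS
    hLnonneg hLdiag (P := P) hP hfix (X := Pseq) h0 hstep
  obtain ⟨P, hP, hfix⟩ := exists_harmonicRiccati_eq hA hQ hS hLnonneg hLdiag hLirr hobs'
  refine ⟨⟨P, ⟨hP, hfix⟩, fun P' ⟨hP', hfix'⟩ => funext fun i => ?_⟩, hconv⟩
  exact tendsto_nhds_unique tendsto_const_nhds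
    (hconv P hP hfix (fun _ => P') hP' (fun _ => hfix') i)
end

section
/- Let A ∈ ℝ^{n×n} be invertible, let C_i ∈ ℝ^{m_i×n} (i = 1, …, N) satisfy collective observability (the only x ∈ ℝ^n with C_i A^k x = 0 for all i and all integers k ≥ 0 is x = 0), let Q ∈ ℝ^{n×n} and R_i ∈ ℝ^{m_i×m_i} be positive definite, and let L = [l_ij] be an N×N matrix that is symmetric, has nonnegative entries, positive diagonal entries, row sums equal to 1, and is irreducible (for all i, j there exists m ≥ 1 with (L^m)_{ij} > 0). Let P_{i,0} be positive definite and define the recursion P_{i,k+1} = A(∑_{j=1}^N l_ij P_{j,k}⁻¹ + C_iᵀ R_i⁻¹ C_i)⁻¹ Aᵀ + Q. Then P_{i,k} > Q for all i and all k ≥ 1, and there exists a positive definite matrix P̄ such that P_{i,k} ≤ P̄ for all i and all k ≥ 1. -/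
open Matrix Filter

section LoewnerOrder

open scoped MatrixOrder

theorem Matrix.smul_mono_loewner {ι : Type*} {M N : Matrix ι ι ℝ} {c : ℝ} (hc : 0 ≤ c) (h : M ≤ N) :
    c • M ≤ c • N := by
  have := (show (N - M).PosSemidef from h).smul hc
  rwa [smul_sub] at this

theorem Matrix.transpose_mul_mul_mono {ι κ : Type*} [Fintype ι] [Fintype κ] {M N : Matrix ι ι ℝ}
    (B : Matrix ι κ ℝ) (h : M ≤ N) : Bᵀ * M * B ≤ Bᵀ * N * B := by
  have := (show (N - M).PosSemidef from h).conjTranspose_mul_mul_same B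
  rw [Matrix.conjTranspose_eq_transpose_of_trivial, Matrix.mul_sub, Matrix.sub_mul] at this
  exact this

variable {ι : Type*} [Fintype ι] [DecidableEq ι]

/-- Inversion is antitone on positive definite real matrices. -/
theorem Matrix.PosDef.inv_anti {M N : Matrix ι ι ℝ} (hM : M.PosDef) (h : M ≤ N) : N⁻¹ ≤ M⁻¹ := by
  have hD : (N - M).PosSemidef := h
  have hN : N.PosDef := by simpa using hM.add_posSemidef hD
  have hMu : IsUnit M.det := (Matrix.isUnit_iff_isUnit_det _).1 hM.isUnit
  have hNu : IsUnit N.det := (Matrix.isUnit_iff_isUnit_det _).1 hN.isUnit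
  have key : M⁻¹ - N⁻¹ =
      N⁻¹ * ((N - M) + (N - M) * M⁻¹ * (N - M)) * N⁻¹ := by
    have h1 : (N - M) + (N - M) * M⁻¹ * (N - M) = N * M⁻¹ * (N - M) := by
      simp only [sub_mul, mul_sub, Matrix.mul_assoc, Matrix.nonsing_inv_mul _ hMu,
        Matrix.mul_nonsing_inv_cancel_left _ _ hMu, Matrix.mul_one]
      abel
    rw [h1, Matrix.mul_assoc N, ← Matrix.mul_assoc N⁻¹, Matrix.nonsing_inv_mul _ hNu,
      Matrix.one_mul, Matrix.mul_sub, Matrix.nonsing_inv_mul _ hMu, Matrix.sub_mul,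
      Matrix.mul_assoc, Matrix.mul_nonsing_inv _ hNu, Matrix.mul_one, Matrix.one_mul]
  have hDD : ((N - M) * M⁻¹ * (N - M)).PosSemidef := by
    have := hM.inv.posSemidef.conjTranspose_mul_mul_same (N - M)
    rwa [hD.isHermitian.eq] at this
  have hfin := (hD.add hDD).conjTranspose_mul_mul_same N⁻¹
  rw [hN.inv.isHermitian.eq, ← key] at hfin
  exact hfin

/-- A positive definite real matrix dominates a positive multiple of the identity. -/
theorem Matrix.PosDef.exists_smul_one_le {M : Matrix ι ι ℝ} (hM : M.PosDef) :
    ∃ w : ℝ, 0 < w ∧ w • (1 : Matrix ι ι ℝ) ≤ M := by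
  obtain ⟨w, hw, hle⟩ : ∃ w : ℝ, 0 < w ∧ ∀ i, w ≤ hM.isHermitian.eigenvalues i := by
    cases isEmpty_or_nonempty ι
    · exact ⟨1, one_pos, fun i => isEmptyElim i⟩
    · obtain ⟨i, hi⟩ := Finite.exists_min hM.isHermitian.eigenvalues
      exact ⟨_, hM.eigenvalues_pos i, hi⟩
  refine ⟨w, hw, ?_⟩
  change (M - w • (1 : Matrix ι ι ℝ)).PosSemidef
  rw [Matrix.posSemidef_iff_isHermitian_and_spectrum_nonneg]
  refine ⟨hM.isHermitian.sub (by simp [Matrix.IsHermitian]), ?_⟩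
  intro x hx
  rw [← Algebra.algebraMap_eq_smul_one, ← spectrum.sub_singleton_eq,
    hM.isHermitian.spectrum_real_eq_range_eigenvalues] at hx
  obtain ⟨_, ⟨i, rfl⟩, _, rfl, rfl⟩ := Set.mem_sub.1 hx
  exact sub_nonneg.2 (hle i)

/-- Any two positive definite real matrices are comparable up to a positive factor. -/
theorem Matrix.PosDef.exists_smul_le {M N : Matrix ι ι ℝ} (hM : M.PosDef) (hN : N.PosDef) :
    ∃ c : ℝ, 0 < c ∧ c • N ≤ M := by
  obtain ⟨w, hw, hwM⟩ := hM.exists_smul_one_le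
  obtain ⟨q, hq, hqN⟩ := hN.inv.exists_smul_one_le
  have hNu : IsUnit N.det := (Matrix.isUnit_iff_isUnit_det _).1 hN.isUnit
  have h1 := (Matrix.PosDef.one.smul hq).inv_anti hqN
  have h2 : (q • (1 : Matrix ι ι ℝ))⁻¹ = q⁻¹ • 1 := by
    apply Matrix.inv_eq_right_inv
    simp [hq.ne']
  rw [Matrix.nonsing_inv_nonsing_inv _ hNu, h2] at h1
  refine ⟨w * q, by positivity, le_trans ?_ hwM⟩
  have h3 : (w * q) • N ≤ (w * q) • (q⁻¹ • (1 : Matrix ι ι ℝ)) :=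
    Matrix.smul_mono_loewner (by positivity) h1
  rwa [smul_smul, mul_assoc, mul_inv_cancel₀ hq.ne', mul_one] at h3

/-- If `c • Q ≤ W` with `W` positive definite, then `(W + Q)⁻¹` dominates a fixed
multiple of `W⁻¹`. -/
theorem Matrix.PosDef.smul_inv_le_add_inv {W Q : Matrix ι ι ℝ} (hW : W.PosDef) (hQ : Q.PosDef)
    {c : ℝ} (hc : 0 < c) (h : c • Q ≤ W) : (1 + c⁻¹)⁻¹ • W⁻¹ ≤ (W + Q)⁻¹ := by
  have hb : 0 < 1 + c⁻¹ := by positivity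
  have hle : W + Q ≤ (1 + c⁻¹) • W := by
    have := (show (W - c • Q).PosSemidef from h).smul (inv_nonneg.2 hc.le)
    rw [smul_sub, smul_smul, inv_mul_cancel₀ hc.ne', one_smul] at this
    rw [add_smul, one_smul]
    exact add_le_add_right this W
  have hWu : IsUnit W.det := (Matrix.isUnit_iff_isUnit_det _).1 hW.isUnit
  have h2 : ((1 + c⁻¹) • W)⁻¹ = (1 + c⁻¹)⁻¹ • W⁻¹ := by
    apply Matrix.inv_eq_right_inv
    rw [Matrix.smul_mul, Matrix.mul_smul, Matrix.mul_nonsing_inv _ hWu, smul_smul,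
      mul_inv_cancel₀ hb.ne', one_smul]
  rw [← h2]
  exact (hW.add hQ).inv_anti hle

end LoewnerOrder

/-- If `C A^s x = 0` for all `s ≤ n`, where `A` is `n × n`, then `C A^k x = 0` for all `k`. -/
theorem Matrix.mulVec_pow_mulVec_eq_zero_of_le {n : ℕ} {κ : Type*}
    (A : Matrix (Fin n) (Fin n) ℝ) (C : Matrix κ (Fin n) ℝ) (x : Fin n → ℝ)
    (h : ∀ s ≤ n, C *ᵥ (A ^ s *ᵥ x) = 0) (k : ℕ) : C *ᵥ (A ^ k *ᵥ x) = 0 := by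
  have hdeg : (Polynomial.X ^ k %ₘ A.charpoly).natDegree < n + 1 := by
    have := Polynomial.natDegree_modByMonic_le (Polynomial.X ^ k) A.charpoly_monic
    rw [Matrix.charpoly_natDegree_eq_dim, Fintype.card_fin] at this
    omega
  rw [Matrix.pow_eq_aeval_mod_charpoly, Polynomial.aeval_eq_sum_range' hdeg, Matrix.sum_mulVec,
    Matrix.mulVec_sum]
  refine Finset.sum_eq_zero fun s hs => ?_
  rw [Matrix.smul_mulVec, Matrix.mulVec_smul, h s (Nat.lt_succ_iff.1 (Finset.mem_range.1 hs)),
    smul_zero]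

/-- A nonnegative irreducible matrix with positive diagonal is primitive. -/
theorem Matrix.exists_forall_pow_pos {N : ℕ} (L : Matrix (Fin N) (Fin N) ℝ)
    (hnonneg : ∀ i j, 0 ≤ L i j) (hdiag : ∀ i, 0 < L i i)
    (hirr : ∀ i j, ∃ k : ℕ, 1 ≤ k ∧ 0 < (L ^ k) i j) :
    ∃ T : ℕ, ∀ t, T ≤ t → ∀ i j, 0 < (L ^ t) i j := by
  have hpow : ∀ t i j, 0 ≤ (L ^ t) i j := by
    intro t
    induction t with
    | zero =>
      intro i j
      rw [pow_zero, Matrix.one_apply]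
      split_ifs <;> norm_num
    | succ t ih =>
      intro i j
      rw [pow_succ, Matrix.mul_apply]
      exact Finset.sum_nonneg fun l _ => mul_nonneg (ih i l) (hnonneg l j)
  choose f _ hf using hirr
  refine ⟨∑ i, ∑ j, f i j, fun t ht i j => ?_⟩
  have hle : f i j ≤ t := by
    refine le_trans ?_ ht
    refine le_trans ?_ (Finset.single_le_sum (f := fun i => ∑ j, f i j)
      (fun _ _ => Nat.zero_le _) (Finset.mem_univ i))
    exact Finset.single_le_sum (f := fun j => f i j)
      (fun _ _ => Nat.zero_le _) (Finset.mem_univ j)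
  clear ht
  induction t, hle using Nat.le_induction with
  | base => exact hf i j
  | succ t _ ih =>
    rw [pow_succ, Matrix.mul_apply]
    exact (mul_pos ih (hdiag j)).trans_le (Finset.single_le_sum
      (f := fun l => (L ^ t) i l * L l j)
      (fun l _ => mul_nonneg (hpow t i l) (hnonneg l j)) (Finset.mem_univ j))

/-- The information matrices accumulated after `t` steps of the coupled recursion when every
prediction step discounts information by the factor `β`, started from no information. -/
noncomputable def discountedInfo {n N : ℕ} (β : ℝ) (A : Matrix (Fin n) (Fin n) ℝ)
    (L : Matrix (Fin N) (Fin N) ℝ) (V : Fin N → Matrix (Fin n) (Fin n) ℝ) :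
    ℕ → Fin N → Matrix (Fin n) (Fin n) ℝ
  | 0, _ => 0
  | t + 1, i => β • ((A⁻¹)ᵀ * (∑ j, L i j • discountedInfo β A L V t j + V i) * A⁻¹)

section DiscountedInfo

variable {n N : ℕ} {β : ℝ} {A : Matrix (Fin n) (Fin n) ℝ} {L : Matrix (Fin N) (Fin N) ℝ}
  {V : Fin N → Matrix (Fin n) (Fin n) ℝ}

theorem discountedInfo_posSemidef (hβ : 0 ≤ β) (hL : ∀ i j, 0 ≤ L i j)
    (hV : ∀ i, (V i).PosSemidef) (t : ℕ) (i : Fin N) :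
    (discountedInfo β A L V t i).PosSemidef := by
  induction t generalizing i with
  | zero => exact Matrix.PosSemidef.zero
  | succ t ih =>
    have hS : (∑ j, L i j • discountedInfo β A L V t j + V i).PosSemidef :=
      (Matrix.posSemidef_sum _ fun j _ => (ih j).smul (hL i j)).add (hV i)
    have := hS.conjTranspose_mul_mul_same A⁻¹
    rw [Matrix.conjTranspose_eq_transpose_of_trivial] at this
    exact this.smul hβ

/-- A direction `A ^ t x` carrying no accumulated information at node `i` is invisible, `s` steps
after `x`, at every node reachable from `i` in the remaining `t - 1 - s` steps. -/
theorem discountedInfo_eq_zero (hβ : 0 < β) (hA : IsUnit A.det) (hL : ∀ i j, 0 ≤ L i j)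
    (hV : ∀ i, (V i).PosSemidef) (x : Fin n → ℝ) (t : ℕ) (i : Fin N)
    (h : (A ^ t *ᵥ x) ⬝ᵥ (discountedInfo β A L V t i *ᵥ (A ^ t *ᵥ x)) = 0)
    (s u : ℕ) (hsu : s + 1 + u = t) (j : Fin N) (hj : 0 < (L ^ u) i j) :
    (A ^ s *ᵥ x) ⬝ᵥ (V j *ᵥ (A ^ s *ᵥ x)) = 0 := by
  induction t generalizing i u with
  | zero => omega
  | succ t ih =>
    set y := A ^ t *ᵥ x with hy
    have hAy : A⁻¹ *ᵥ (A *ᵥ y) = y := by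
      rw [Matrix.mulVec_mulVec, Matrix.nonsing_inv_mul _ hA, Matrix.one_mulVec]
    have hG := discountedInfo_posSemidef (A := A) hβ.le hL hV t
    have hGy : ∀ l, 0 ≤ y ⬝ᵥ (discountedInfo β A L V t l *ᵥ y) := fun l => by
      simpa using (hG l).dotProduct_mulVec_nonneg y
    have hVy : 0 ≤ y ⬝ᵥ (V i *ᵥ y) := by simpa using (hV i).dotProduct_mulVec_nonneg y
    have hsum : ∑ l, L i l * (y ⬝ᵥ (discountedInfo β A L V t l *ᵥ y)) + y ⬝ᵥ (V i *ᵥ y) = 0 := by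
      rw [pow_succ', ← Matrix.mulVec_mulVec, ← hy, discountedInfo, Matrix.smul_mulVec,
        dotProduct_smul, ← Matrix.mulVec_mulVec, ← Matrix.mulVec_mulVec, hAy,
        Matrix.dotProduct_mulVec, Matrix.vecMul_transpose, hAy, smul_eq_mul] at h
      simpa [Matrix.add_mulVec, Matrix.sum_mulVec, Matrix.smul_mulVec, dotProduct_add,
        dotProduct_sum, hβ.ne'] using h
    have hnn : ∀ l ∈ Finset.univ, 0 ≤ L i l * (y ⬝ᵥ (discountedInfo β A L V t l *ᵥ y)) :=
      fun l _ => mul_nonneg (hL i l) (hGy l)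
    obtain ⟨h1, h2⟩ := (add_eq_zero_iff_of_nonneg (Finset.sum_nonneg hnn) hVy).1 hsum
    cases u with
    | zero =>
      have hij : i = j := by
        by_contra hne
        simp [hne] at hj
      obtain rfl : s = t := by omega
      exact hij ▸ h2
    | succ u =>
      rw [pow_succ', Matrix.mul_apply] at hj
      obtain ⟨l, hl⟩ : ∃ l, 0 < L i l * (L ^ u) l j := by
        by_contra! hle
        exact absurd (Finset.sum_nonpos fun l _ => hle l) (not_le.2 hj)
      have hLl : 0 < L i l := (hL i l).lt_of_ne' fun h0 => by simp [h0] at hl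
      have h3 := (Finset.sum_eq_zero_iff_of_nonneg hnn).1 h1 l (Finset.mem_univ l)
      exact ih l ((mul_eq_zero.1 h3).resolve_left hLl.ne') u (by omega)
        ((mul_pos_iff_of_pos_left hLl).1 hl)

/-- Under collective observability and primitivity of the coupling, the accumulated information is
eventually positive definite at every node. -/
theorem exists_discountedInfo_posDef (hβ : 0 < β) (hA : IsUnit A.det) (hL : ∀ i j, 0 ≤ L i j)
    (hV : ∀ i, (V i).PosSemidef) (hprim : ∃ T : ℕ, ∀ t, T ≤ t → ∀ i j, 0 < (L ^ t) i j)
    (hobs : ∀ x : Fin n → ℝ,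
      (∀ s ≤ n, ∀ j, (A ^ s *ᵥ x) ⬝ᵥ (V j *ᵥ (A ^ s *ᵥ x)) = 0) → x = 0) :
    ∃ p, ∀ i, (discountedInfo β A L V p i).PosDef := by
  obtain ⟨T, hT⟩ := hprim
  refine ⟨T + n + 1, fun i => ?_⟩
  have hG := discountedInfo_posSemidef (A := A) hβ.le hL hV (T + n + 1) i
  refine Matrix.PosDef.of_dotProduct_mulVec_pos hG.isHermitian fun z hz => ?_
  refine (hG.dotProduct_mulVec_nonneg z).lt_of_ne' fun h0 => hz ?_
  have hAp : IsUnit (A ^ (T + n + 1)).det := by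
    rw [Matrix.det_pow]
    exact hA.pow _
  set x := (A ^ (T + n + 1))⁻¹ *ᵥ z with hx
  have hzx : z = A ^ (T + n + 1) *ᵥ x := by
    rw [hx, Matrix.mulVec_mulVec, Matrix.mul_nonsing_inv _ hAp, Matrix.one_mulVec]
  rw [star_trivial, hzx] at h0
  rw [hzx, hobs x fun s hs j => discountedInfo_eq_zero hβ hA hL hV x _ i h0 s (T + n - s)
    (by omega) j (hT _ (by omega) i j), Matrix.mulVec_zero]

end DiscountedInfo

section Recursion

open scoped MatrixOrder

variable {n N : ℕ} {A Q : Matrix (Fin n) (Fin n) ℝ} {L : Matrix (Fin N) (Fin N) ℝ}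
  {V : Fin N → Matrix (Fin n) (Fin n) ℝ} {P : ℕ → Fin N → Matrix (Fin n) (Fin n) ℝ}

theorem coupledInfo_posDef {Y : Fin N → Matrix (Fin n) (Fin n) ℝ} (hL : ∀ i j, 0 ≤ L i j)
    (hLdiag : ∀ i, 0 < L i i) (hV : ∀ i, (V i).PosSemidef) (hY : ∀ i, (Y i).PosDef) (i : Fin N) :
    (∑ j, L i j • Y j + V i).PosDef := by
  refine Matrix.PosDef.add_posSemidef ?_ (hV i)
  rw [← Finset.add_sum_erase _ _ (Finset.mem_univ i)]
  exact ((hY i).smul (hLdiag i)).add_posSemidef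
    (Matrix.posSemidef_sum _ fun j _ => (hY j).posSemidef.smul (hL i j))

theorem Matrix.PosDef.mul_inv_mul_transpose {S : Matrix (Fin n) (Fin n) ℝ} (hS : S.PosDef)
    (hA : IsUnit A.det) : (A * S⁻¹ * Aᵀ).PosDef := by
  have := hS.inv.mul_mul_conjTranspose_same (B := A)
    (Matrix.vecMul_injective_of_isUnit ((Matrix.isUnit_iff_isUnit_det _).2 hA))
  rwa [Matrix.conjTranspose_eq_transpose_of_trivial] at this

theorem riccati_posDef (hA : IsUnit A.det) (hQ : Q.PosDef) (hL : ∀ i j, 0 ≤ L i j)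
    (hLdiag : ∀ i, 0 < L i i) (hV : ∀ i, (V i).PosSemidef) (hP0 : ∀ i, (P 0 i).PosDef)
    (hrec : ∀ k i, P (k + 1) i = A * (∑ j, L i j • (P k j)⁻¹ + V i)⁻¹ * Aᵀ + Q)
    (k : ℕ) (i : Fin N) : (P k i).PosDef := by
  induction k generalizing i with
  | zero => exact hP0 i
  | succ k ih =>
    rw [hrec]
    exact ((coupledInfo_posDef hL hLdiag hV (fun j => (ih j).inv) i).mul_inv_mul_transpose
      hA).add hQ

theorem riccati_sub_posDef (hA : IsUnit A.det) (hQ : Q.PosDef) (hL : ∀ i j, 0 ≤ L i j)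
    (hLdiag : ∀ i, 0 < L i i) (hV : ∀ i, (V i).PosSemidef) (hP0 : ∀ i, (P 0 i).PosDef)
    (hrec : ∀ k i, P (k + 1) i = A * (∑ j, L i j • (P k j)⁻¹ + V i)⁻¹ * Aᵀ + Q)
    (k : ℕ) (i : Fin N) : (P (k + 1) i - Q).PosDef := by
  rw [hrec, add_sub_cancel_right]
  exact (coupledInfo_posDef hL hLdiag hV (fun j =>
    (riccati_posDef hA hQ hL hLdiag hV hP0 hrec k j).inv) i).mul_inv_mul_transpose hA

/-- One step of the recursion retains a fixed fraction of the coupled information. -/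
theorem exists_discount_le_inv (hA : IsUnit A.det) (hQ : Q.PosDef) (hL : ∀ i j, 0 ≤ L i j)
    (hLdiag : ∀ i, 0 < L i i) (hLrow : ∀ i, ∑ j, L i j = 1) (hV : ∀ i, (V i).PosSemidef)
    (hP0 : ∀ i, (P 0 i).PosDef)
    (hrec : ∀ k i, P (k + 1) i = A * (∑ j, L i j • (P k j)⁻¹ + V i)⁻¹ * Aᵀ + Q) :
    ∃ β : ℝ, 0 < β ∧ ∀ k i,
      β • ((A⁻¹)ᵀ * (∑ j, L i j • (P (k + 1) j)⁻¹ + V i) * A⁻¹) ≤ (P (k + 2) i)⁻¹ := by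
  have hP := riccati_posDef hA hQ hL hLdiag hV hP0 hrec
  have hSbar : (Q⁻¹ + ∑ i, V i).PosDef :=
    hQ.inv.add_posSemidef (Matrix.posSemidef_sum _ fun i _ => hV i)
  obtain ⟨c, hc, hcQ⟩ := (hSbar.mul_inv_mul_transpose hA).exists_smul_le hQ
  refine ⟨(1 + c⁻¹)⁻¹, by positivity, fun k i => ?_⟩
  set S := ∑ j, L i j • (P (k + 1) j)⁻¹ + V i with hSdef
  have hS : S.PosDef := coupledInfo_posDef hL hLdiag hV (fun j => (hP (k + 1) j).inv) i
  have hSle : S ≤ Q⁻¹ + ∑ i, V i := by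
    refine add_le_add ?_ (Finset.single_le_sum (f := V)
      (fun j _ => Matrix.nonneg_iff_posSemidef.2 (hV j)) (Finset.mem_univ i))
    calc ∑ j, L i j • (P (k + 1) j)⁻¹ ≤ ∑ j, L i j • Q⁻¹ :=
          Finset.sum_le_sum fun j _ => Matrix.smul_mono_loewner (hL i j)
            (hQ.inv_anti (riccati_sub_posDef hA hQ hL hLdiag hV hP0 hrec k j).posSemidef)
      _ = Q⁻¹ := by rw [← Finset.sum_smul, hLrow, one_smul]
  have hW := hS.mul_inv_mul_transpose hA
  have hWle := Matrix.transpose_mul_mul_mono Aᵀ (hS.inv_anti hSle)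
  rw [Matrix.transpose_transpose] at hWle
  have hinv : (A * S⁻¹ * Aᵀ)⁻¹ = (A⁻¹)ᵀ * S * A⁻¹ := by
    rw [Matrix.mul_inv_rev, Matrix.mul_inv_rev, Matrix.nonsing_inv_nonsing_inv _
      ((Matrix.isUnit_iff_isUnit_det _).1 hS.isUnit), Matrix.transpose_nonsing_inv,
      Matrix.mul_assoc]
  rw [hrec (k + 1) i, ← hSdef, ← hinv]
  exact hW.smul_inv_le_add_inv hQ hc (hcQ.trans hWle)

/-- The inverse iterates dominate the discounted accumulated information. -/
theorem discountedInfo_le_inv {β : ℝ} (hβ : 0 ≤ β) (hL : ∀ i j, 0 ≤ L i j)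
    (hP : ∀ k i, (P k i).PosDef)
    (hstep : ∀ k i,
      β • ((A⁻¹)ᵀ * (∑ j, L i j • (P (k + 1) j)⁻¹ + V i) * A⁻¹) ≤ (P (k + 2) i)⁻¹)
    (t k : ℕ) (i : Fin N) : discountedInfo β A L V t i ≤ (P (k + t + 1) i)⁻¹ := by
  induction t generalizing i with
  | zero => exact Matrix.nonneg_iff_posSemidef.2 (hP _ i).inv.posSemidef
  | succ t ih =>
    refine le_trans (Matrix.smul_mono_loewner hβ (Matrix.transpose_mul_mul_mono _ ?_))
      (hstep (k + t) i)
    exact add_le_add_left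
      (Finset.sum_le_sum fun j _ => Matrix.smul_mono_loewner (hL i j) (ih j)) _

/-- If the accumulated information is positive definite after `p` steps, the iterates are uniformly
bounded above. -/
theorem exists_posDef_forall_le {G : Fin N → Matrix (Fin n) (Fin n) ℝ} (p : ℕ)
    (hG : ∀ i, (G i).PosDef) (hP : ∀ k i, (P k i).PosDef)
    (hle : ∀ k i, G i ≤ (P (k + p) i)⁻¹) :
    ∃ Pbar : Matrix (Fin n) (Fin n) ℝ, Pbar.PosDef ∧ ∀ i k, P k i ≤ Pbar := by
  have hPnn : ∀ k i, 0 ≤ P k i := fun k i => Matrix.nonneg_iff_posSemidef.2 (hP k i).posSemidef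
  have hGnn : ∀ i, 0 ≤ (G i)⁻¹ := fun i => Matrix.nonneg_iff_posSemidef.2 (hG i).inv.posSemidef
  have h1 : 0 ≤ ∑ i, (G i)⁻¹ := Finset.sum_nonneg fun i _ => hGnn i
  have h2 : 0 ≤ ∑ k ∈ Finset.range p, ∑ i, P k i :=
    Finset.sum_nonneg fun k _ => Finset.sum_nonneg fun i _ => hPnn k i
  have hone : (0 : Matrix (Fin n) (Fin n) ℝ) ≤ 1 :=
    Matrix.nonneg_iff_posSemidef.2 Matrix.PosSemidef.one
  refine ⟨1 + (∑ i, (G i)⁻¹ + ∑ k ∈ Finset.range p, ∑ i, P k i),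
    Matrix.PosDef.one.add_posSemidef (Matrix.nonneg_iff_posSemidef.1 (add_nonneg h1 h2)),
    fun i k => le_add_of_nonneg_of_le hone ?_⟩
  rcases lt_or_ge k p with hk | hk
  · refine le_add_of_nonneg_of_le h1 ?_
    refine le_trans ?_ (Finset.single_le_sum (f := fun k => ∑ i, P k i)
      (fun k _ => Finset.sum_nonneg fun i _ => hPnn k i) (Finset.mem_range.2 hk))
    exact Finset.single_le_sum (f := fun i => P k i) (fun i _ => hPnn k i) (Finset.mem_univ i)
  · refine le_add_of_le_of_nonneg ?_ h2
    refine le_trans ?_ (Finset.single_le_sum (f := fun i => (G i)⁻¹)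
      (fun i _ => hGnn i) (Finset.mem_univ i))
    have := (hG i).inv_anti (hle (k - p) i)
    rwa [Nat.sub_add_cancel hk, Matrix.nonsing_inv_nonsing_inv _
      ((Matrix.isUnit_iff_isUnit_det _).1 (hP k i).isUnit)] at this

end Recursion

/-- for the harmonic-coupled Riccati recursion
`P_{i,k+1} = A(∑_j l_ij P_{j,k}⁻¹ + C_iᵀ R_i⁻¹ C_i)⁻¹ Aᵀ + Q` started from positive
definite initial values, one has `P_{i,k} > Q` for all `i` and all `k ≥ 1`, and the iterates
are uniformly bounded above by some positive definite matrix `P̄`. -/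
theorem hcrr_lower_and_uniform_upper_bound {n N : ℕ}
    (A : Matrix (Fin n) (Fin n) ℝ) (hA : IsUnit A.det)
    (m : Fin N → ℕ)
    (C : ∀ i, Matrix (Fin (m i)) (Fin n) ℝ)
    (hobs : ∀ x : Fin n → ℝ, (∀ i (k : ℕ), (C i).mulVec ((A ^ k).mulVec x) = 0) → x = 0)
    (Q : Matrix (Fin n) (Fin n) ℝ) (hQ : Q.PosDef)
    (R : ∀ i, Matrix (Fin (m i)) (Fin (m i)) ℝ) (hR : ∀ i, (R i).PosDef)
    (L : Matrix (Fin N) (Fin N) ℝ) (hLsymm : L.IsSymm)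
    (hLnonneg : ∀ i j, 0 ≤ L i j) (hLdiag : ∀ i, 0 < L i i)
    (hLrow : ∀ i, ∑ j, L i j = 1)
    (hLirr : ∀ i j, ∃ k : ℕ, 1 ≤ k ∧ 0 < (L ^ k) i j)
    (Pseq : ℕ → Fin N → Matrix (Fin n) (Fin n) ℝ)
    (hP0 : ∀ i, (Pseq 0 i).PosDef)
    (hrec : ∀ k i, Pseq (k + 1) i =
      A * (∑ j, L i j • (Pseq k j)⁻¹ + (C i)ᵀ * (R i)⁻¹ * C i)⁻¹ * Aᵀ + Q) :
    (∀ i, ∀ k : ℕ, 1 ≤ k → (Pseq k i - Q).PosDef) ∧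
    (∃ Pbar : Matrix (Fin n) (Fin n) ℝ, Pbar.PosDef ∧
      ∀ i, ∀ k : ℕ, 1 ≤ k → (Pbar - Pseq k i).PosSemidef) := by
  have hV : ∀ i, ((C i)ᵀ * (R i)⁻¹ * C i).PosSemidef := fun i => by
    have := (hR i).inv.posSemidef.conjTranspose_mul_mul_same (C i)
    rwa [Matrix.conjTranspose_eq_transpose_of_trivial] at this
  have hP := riccati_posDef hA hQ hLnonneg hLdiag hV hP0 hrec
  refine ⟨fun i k hk => ?_, ?_⟩
  · obtain ⟨k, rfl⟩ := Nat.exists_eq_add_of_le' hk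
    exact riccati_sub_posDef hA hQ hLnonneg hLdiag hV hP0 hrec k i
  obtain ⟨β, hβ, hstep⟩ := exists_discount_le_inv hA hQ hLnonneg hLdiag hLrow hV hP0 hrec
  have hVzero : ∀ i (z : Fin n → ℝ),
      z ⬝ᵥ (((C i)ᵀ * (R i)⁻¹ * C i) *ᵥ z) = 0 → C i *ᵥ z = 0 := fun i z hz => by
    by_contra hne
    have hpos := (hR i).inv.dotProduct_mulVec_pos hne
    rw [← Matrix.mulVec_mulVec, ← Matrix.mulVec_mulVec, Matrix.dotProduct_mulVec,
      Matrix.vecMul_transpose] at hz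
    rw [star_trivial, hz] at hpos
    exact lt_irrefl _ hpos
  obtain ⟨p, hp⟩ := exists_discountedInfo_posDef hβ hA hLnonneg hV
    (L.exists_forall_pow_pos hLnonneg hLdiag hLirr) fun x hx => hobs x fun i k =>
      Matrix.mulVec_pow_mulVec_eq_zero_of_le A (C i) x (fun s hs => hVzero i _ (hx s hs i)) k
  obtain ⟨Pbar, hPbar, hle⟩ := exists_posDef_forall_le (p + 1) hp hP fun k i =>
    discountedInfo_le_inv hβ.le hLnonneg hP hstep p k i
  exact ⟨Pbar, hPbar, fun i k _ => hle i k⟩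
end

section
/- Let A ∈ ℝ^{n×n} and C ∈ ℝ^{m×n} with the pair (A, C) observable (the only x ∈ ℝ^n with C A^k x = 0 for all integers k ≥ 0 is x = 0). Let Q_1 ≥ Q_2 be positive definite n×n matrices and R_1 ≥ R_2 be positive definite m×m matrices. If P_1 is a positive definite solution of P_1 = A(P_1⁻¹ + Cᵀ R_1⁻¹ C)⁻¹ Aᵀ + Q_1 and P_2 is a positive definite solution of P_2 = A(P_2⁻¹ + Cᵀ R_2⁻¹ C)⁻¹ Aᵀ + Q_2, then P_1 ≥ P_2. -/
open Matrix

namespace Matrix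

section LoewnerOrder

open scoped MatrixOrder

theorem PosDef.inv_le_inv_of_le {ι : Type*} [Fintype ι] [DecidableEq ι]
    {X Y : Matrix ι ι ℝ} (hX : X.PosDef) (hY : Y.PosDef)
    (h : Y ≤ X) : X⁻¹ ≤ Y⁻¹ := by
  have := hX.isUnit.invertible
  have := hY.inv.isUnit.invertible
  have hYY : Y⁻¹⁻¹ = Y := nonsing_inv_nonsing_inv Y ((isUnit_iff_isUnit_det Y).1 hY.isUnit)
  have h₁ := PosDef.fromBlocks₁₁ (1 : Matrix ι ι ℝ) Y⁻¹ hX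
  have h₂ := PosDef.fromBlocks₂₂ X (1 : Matrix ι ι ℝ) hY.inv
  simp only [conjTranspose_one, one_mul, mul_one, hYY] at h₁ h₂
  exact h₁.1 (h₂.2 h)

theorem smul_le_smul_of_nonneg_right {ι : Type*} {X : Matrix ι ι ℝ} (hX : X.PosSemidef) {a b : ℝ}
    (hab : a ≤ b) : a • X ≤ b • X := by
  rw [le_iff, ← sub_smul]
  exact hX.smul (sub_nonneg.2 hab)

theorem smul_le_smul_of_nonneg_left {ι : Type*} {X Y : Matrix ι ι ℝ} (h : X ≤ Y) {a : ℝ}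
    (ha : 0 ≤ a) : a • X ≤ a • Y := by
  rw [le_iff, ← smul_sub]
  exact PosSemidef.smul h ha

theorem mul_mul_transpose_le {ι : Type*} [Fintype ι]
    {κ : Type*} [Finite κ] {X Y : Matrix ι ι ℝ} (h : X ≤ Y)
    (B : Matrix κ ι ℝ) : B * X * Bᵀ ≤ B * Y * Bᵀ := by
  have := Matrix.PosSemidef.mul_mul_conjTranspose_same (Matrix.le_iff.1 h) B
  rw [conjTranspose_eq_transpose_of_trivial] at this
  rwa [Matrix.mul_sub, Matrix.sub_mul] at this

theorem PosDef.inv_smul_eq {ι : Type*} [Fintype ι] [DecidableEq ι]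
    {X : Matrix ι ι ℝ} (hX : X.PosDef) {t : ℝ} (ht : t ≠ 0) :
    (t • X)⁻¹ = t⁻¹ • X⁻¹ := by
  have := invertibleOfNonzero ht
  rw [inv_smul X t ((isUnit_iff_isUnit_det X).1 hX.isUnit), invOf_eq_inv]

theorem PosDef.exists_smul_le_s10 {ι : Type*} [Fintype ι] [DecidableEq ι]
    {X Y : Matrix ι ι ℝ} (hX : X.PosDef) (hY : Y.PosDef) :
    ∃ c : ℝ, 0 < c ∧ c < 1 ∧ c • Y ≤ X := by
  cases isEmpty_or_nonempty ι
  · exact ⟨1 / 2, by norm_num, by norm_num, (Subsingleton.elim _ _).le⟩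
  have key (Z : Matrix ι ι ℝ) (hZ : Z.PosDef) : ∃ r : ℝ, 0 < r ∧ r • 1 ≤ Z := by
    obtain ⟨r, hr, h⟩ := (CFC.exists_pos_algebraMap_le_iff (a := Z) hZ.isHermitian).2
      fun x hx => hZ.isStrictlyPositive.spectrum_pos hx
    exact ⟨r, hr, by rwa [Algebra.algebraMap_eq_smul_one] at h⟩
  obtain ⟨r, hr, hrX⟩ := key X hX
  obtain ⟨s, hs, hsY⟩ := key Y⁻¹ hY.inv
  have hone : (1 : Matrix ι ι ℝ).PosDef := .one
  have hYs : Y ≤ s⁻¹ • 1 := by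
    have := hY.inv.inv_le_inv_of_le (hone.smul hs) hsY
    rwa [hone.inv_smul_eq hs.ne', inv_one,
      nonsing_inv_nonsing_inv Y ((isUnit_iff_isUnit_det Y).1 hY.isUnit)] at this
  refine ⟨min (r * s) (1 / 2), by positivity, by simp; right; norm_num, ?_⟩
  calc min (r * s) (1 / 2) • Y ≤ (r * s) • Y :=
        smul_le_smul_of_nonneg_right hY.posSemidef (min_le_left _ _)
    _ ≤ (r * s) • s⁻¹ • (1 : Matrix ι ι ℝ) := smul_le_smul_of_nonneg_left hYs (by positivity)
    _ = r • 1 := by rw [smul_smul, mul_assoc, mul_inv_cancel₀ hs.ne', mul_one]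
    _ ≤ X := hrX

theorem smul_inv_add_inv_le {ι : Type*} [Fintype ι] [DecidableEq ι]
    {P₁ P₂ S₁ S₂ : Matrix ι ι ℝ} (hP₁ : P₁.PosDef) (hP₂ : P₂.PosDef)
    (hS₁ : S₁.PosSemidef) (hS₂ : S₂.PosSemidef) (hS : S₁ ≤ S₂) {t : ℝ} (ht : 0 < t)
    (ht₁ : t ≤ 1) (h : t • P₂ ≤ P₁) :
    t • (P₂⁻¹ + S₂)⁻¹ ≤ (P₁⁻¹ + S₁)⁻¹ := by
  have hM₂ : (P₂⁻¹ + S₂).PosDef := hP₂.inv.add_posSemidef hS₂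
  have hle : P₁⁻¹ + S₁ ≤ t⁻¹ • (P₂⁻¹ + S₂) := by
    rw [smul_add]
    refine add_le_add ?_ (hS.trans ?_)
    · rw [← hP₂.inv_smul_eq ht.ne']
      exact hP₁.inv_le_inv_of_le (hP₂.smul ht) h
    · simpa using smul_le_smul_of_nonneg_right hS₂ ((one_le_inv₀ ht).2 ht₁)
  have := (hM₂.smul (inv_pos.2 ht)).inv_le_inv_of_le (hP₁.inv.add_posSemidef hS₁) hle
  rwa [hM₂.inv_smul_eq (inv_ne_zero ht.ne'), inv_inv] at this

theorem le_of_forall_smul_le {ι : Type*} [Fintype ι]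
    {X Y : Matrix ι ι ℝ} (hX : X.PosDef) (hY : Y.PosDef)
    {t : ℕ → ℝ} (ht : Filter.Tendsto t Filter.atTop (nhds 1)) (h : ∀ k, t k • Y ≤ X) :
    Y ≤ X := by
  refine .of_dotProduct_mulVec_nonneg (hX.isHermitian.sub hY.isHermitian) fun x => ?_
  have hk (k : ℕ) : t k * (star x ⬝ᵥ Y *ᵥ x) ≤ star x ⬝ᵥ X *ᵥ x := by
    have := (le_iff.1 (h k)).dotProduct_mulVec_nonneg x
    rw [sub_mulVec, dotProduct_sub, smul_mulVec, dotProduct_smul, smul_eq_mul] at this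
    exact sub_nonneg.1 this
  have := le_of_tendsto' (ht.mul_const (star x ⬝ᵥ Y *ᵥ x)) hk
  rw [sub_mulVec, dotProduct_sub]
  linarith

theorem riccati_solution_mono {ι : Type*} [Fintype ι] [DecidableEq ι]
    (A : Matrix ι ι ℝ) {P₁ P₂ Q₁ Q₂ S₁ S₂ : Matrix ι ι ℝ}
    (hP₁ : P₁.PosDef) (hP₂ : P₂.PosDef) (hQ₂ : Q₂.PosDef) (hQ : Q₂ ≤ Q₁)
    (hS₁ : S₁.PosSemidef) (hS₂ : S₂.PosSemidef) (hS : S₁ ≤ S₂)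
    (heq₁ : P₁ = A * (P₁⁻¹ + S₁)⁻¹ * Aᵀ + Q₁) (heq₂ : P₂ = A * (P₂⁻¹ + S₂)⁻¹ * Aᵀ + Q₂) :
    P₂ ≤ P₁ := by
  obtain ⟨c, hc, hc₁, hcQ⟩ := hQ₂.exists_smul_le_s10 hP₂
  have step (t : ℝ) (ht : 0 < t) (ht₁ : t ≤ 1) (h : t • P₂ ≤ P₁) :
      (t + (1 - t) * c) • P₂ ≤ P₁ := by
    have hA := mul_mul_transpose_le (smul_inv_add_inv_le hP₁ hP₂ hS₁ hS₂ hS ht ht₁ h) A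
    calc (t + (1 - t) * c) • P₂ = t • P₂ + (1 - t) • c • P₂ := by rw [add_smul, smul_smul]
      _ ≤ t • P₂ + (1 - t) • Q₂ :=
        add_le_add le_rfl (smul_le_smul_of_nonneg_left hcQ (sub_nonneg.2 ht₁))
      _ = A * (t • (P₂⁻¹ + S₂)⁻¹) * Aᵀ + Q₂ := by
        conv_lhs => rw [heq₂]
        rw [mul_smul_comm, smul_mul_assoc, smul_add, sub_smul, one_smul]
        abel
      _ ≤ A * (P₁⁻¹ + S₁)⁻¹ * Aᵀ + Q₁ := add_le_add hA hQ
      _ = P₁ := heq₁.symm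
  have base : c • P₂ ≤ P₁ := by
    have hA := (hP₁.inv.add_posSemidef hS₁).inv.posSemidef.mul_mul_conjTranspose_same A
    rw [conjTranspose_eq_transpose_of_trivial] at hA
    rw [heq₁]
    exact (hcQ.trans hQ).trans (le_add_of_nonneg_left hA.nonneg)
  have hpow (k : ℕ) : (1 - (1 - c) ^ (k + 1)) • P₂ ≤ P₁ := by
    induction k with
    | zero => simpa using base
    | succ k ih =>
      have h := step _ (sub_pos.2 (pow_lt_one₀ (by linarith) (by linarith) k.succ_ne_zero))
        (sub_le_self _ (pow_nonneg (by linarith) _)) ih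
      convert h using 2
      rw [Nat.succ_eq_add_one]
      ring
  refine le_of_forall_smul_le hP₁ hP₂ ?_ hpow
  have := (tendsto_pow_atTop_nhds_zero_of_lt_one (r := 1 - c) (by linarith) (by linarith)).comp
    (Filter.tendsto_add_atTop_nat 1)
  simpa using this.const_sub 1

end LoewnerOrder

end Matrix

/-- with `(A, C)` observable, `Q_1 ≥ Q_2 > 0` and `R_1 ≥ R_2 > 0`, positive
definite solutions of the information-form DAREs
`P_i = A(P_i⁻¹ + Cᵀ R_i⁻¹ C)⁻¹ Aᵀ + Q_i` satisfy `P_1 ≥ P_2`. -/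
theorem dare_preserves_order {n m : ℕ}
    (A : Matrix (Fin n) (Fin n) ℝ) (C : Matrix (Fin m) (Fin n) ℝ)
    (hobs : ∀ x : Fin n → ℝ, (∀ k : ℕ, C.mulVec ((A ^ k).mulVec x) = 0) → x = 0)
    (Q₁ Q₂ : Matrix (Fin n) (Fin n) ℝ) (hQ₁ : Q₁.PosDef) (hQ₂ : Q₂.PosDef)
    (hQ : (Q₁ - Q₂).PosSemidef)
    (R₁ R₂ : Matrix (Fin m) (Fin m) ℝ) (hR₁ : R₁.PosDef) (hR₂ : R₂.PosDef)
    (hRord : (R₁ - R₂).PosSemidef)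
    (P₁ P₂ : Matrix (Fin n) (Fin n) ℝ) (hP₁ : P₁.PosDef) (hP₂ : P₂.PosDef)
    (heq₁ : P₁ = A * (P₁⁻¹ + Cᵀ * R₁⁻¹ * C)⁻¹ * Aᵀ + Q₁)
    (heq₂ : P₂ = A * (P₂⁻¹ + Cᵀ * R₂⁻¹ * C)⁻¹ * Aᵀ + Q₂) :
    (P₁ - P₂).PosSemidef := by
  have hinfo {R : Matrix (Fin m) (Fin m) ℝ} (hR : R.PosSemidef) :
      (Cᵀ * R * C).PosSemidef := by
    simpa [conjTranspose_eq_transpose_of_trivial] using hR.conjTranspose_mul_mul_same C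
  refine riccati_solution_mono A hP₁ hP₂ hQ₂ hQ (hinfo hR₁.inv.posSemidef)
    (hinfo hR₂.inv.posSemidef) ?_ heq₁ heq₂
  simpa using mul_mul_transpose_le (hR₁.inv_le_inv_of_le hR₂ hRord) Cᵀ
end

section
/- Let A ∈ ℝ^{n×n} be invertible, let C_i ∈ ℝ^{m_i×n} (i = 1, …, N) satisfy collective observability (the only x ∈ ℝ^n with C_i A^k x = 0 for all i and all integers k ≥ 0 is x = 0), and let L = [l_ij] be an N×N matrix that is symmetric, has nonnegative entries, positive diagonal entries, row sums equal to 1, and is irreducible. Let Q_1 ≥ Q_2 be positive definite n×n matrices and, for each i, let R_{1,i} ≥ R_{2,i} be positive definite m_i×m_i matrices. If (P_{1,1}, …, P_{1,N}) is a family of positive definite solutions of P_{1,i} = A(∑_{j=1}^N l_ij P_{1,j}⁻¹ + C_iᵀ R_{1,i}⁻¹ C_i)⁻¹ Aᵀ + Q_1 and (P_{2,1}, …, P_{2,N}) is a family of positive definite solutions of P_{2,i} = A(∑_{j=1}^N l_ij P_{2,j}⁻¹ + C_iᵀ R_{2,i}⁻¹ C_i)⁻¹ Aᵀ + Q_2,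 then P_{1,i} ≥ P_{2,i} for every i. -/
open Matrix

section Order

open scoped MatrixOrder

namespace Matrix

variable {n : Type*} [Fintype n] [DecidableEq n]

theorem PosDef.inv_le_inv_s11 {A B : Matrix n n ℝ} (hA : A.PosDef) (hB : B.PosDef) (hAB : A ≤ B) :
    B⁻¹ ≤ A⁻¹ := by
  have hAu : IsUnit A.det := (isUnit_iff_isUnit_det A).1 hA.isUnit
  have hBu : IsUnit B.det := (isUnit_iff_isUnit_det B).1 hB.isUnit
  have h₁ := (le_iff.1 hAB).conjTranspose_mul_mul_same B⁻¹
  have h₂ := hA.posSemidef.conjTranspose_mul_mul_same (A⁻¹ - B⁻¹)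
  rw [hB.inv.isHermitian.eq] at h₁
  rw [(hA.inv.isHermitian.sub hB.inv.isHermitian).eq] at h₂
  have key : A⁻¹ - B⁻¹ = B⁻¹ * (B - A) * B⁻¹ + (A⁻¹ - B⁻¹) * A * (A⁻¹ - B⁻¹) := by
    simp only [sub_mul, mul_sub, nonsing_inv_mul _ hAu, nonsing_inv_mul _ hBu,
      mul_nonsing_inv_cancel_right _ _ hAu, one_mul]
    abel
  rw [le_iff, key]
  exact h₁.add h₂

theorem smul_le_smul_of_nonneg_right_s11 {m : Type*} {A : Matrix m m ℝ} (hA : A.PosSemidef) {a b : ℝ}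
    (hab : a ≤ b) : a • A ≤ b • A := by
  rw [le_iff, ← sub_smul]
  exact hA.smul (sub_nonneg.2 hab)

theorem IsHermitian.exists_le_smul_one {A : Matrix n n ℝ} (hA : A.IsHermitian) :
    ∃ c : ℝ, 0 < c ∧ A ≤ c • (1 : Matrix n n ℝ) := by
  have hs : 0 ≤ ∑ i, ∑ j, |A i j| := by positivity
  refine ⟨∑ i, ∑ j, |A i j| + 1, by linarith, ?_⟩
  refine .of_dotProduct_mulVec_nonneg
    (IsHermitian.sub (isHermitian_one.smul (IsSelfAdjoint.all _)) hA) fun x ↦ ?_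
  have hx : 0 ≤ x ⬝ᵥ x := by simpa using dotProduct_star_self_nonneg x
  have hsq (i : n) : x i * x i ≤ x ⬝ᵥ x :=
    Finset.single_le_sum (f := fun i ↦ x i * x i) (fun j _ ↦ mul_self_nonneg _) (Finset.mem_univ i)
  have hA' : x ⬝ᵥ A *ᵥ x ≤ (∑ i, ∑ j, |A i j|) * (x ⬝ᵥ x) := by
    rw [Finset.sum_mul]
    refine Finset.sum_le_sum fun i _ ↦ ?_
    rw [mulVec, dotProduct, Finset.mul_sum, Finset.sum_mul]
    refine Finset.sum_le_sum fun j _ ↦ ?_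
    have h : |x i * x j| ≤ x ⬝ᵥ x := by
      rw [abs_le]
      constructor <;> nlinarith [hsq i, hsq j, sq_nonneg (x i + x j), sq_nonneg (x i - x j)]
    calc x i * (A i j * x j) = A i j * (x i * x j) := by ring
      _ ≤ |A i j| * |x i * x j| := by rw [← abs_mul]; exact le_abs_self _
      _ ≤ |A i j| * (x ⬝ᵥ x) := by gcongr
  rw [star_trivial, sub_mulVec, smul_mulVec, one_mulVec, dotProduct_sub, dotProduct_smul,
    smul_eq_mul]
  linarith

theorem PosDef.exists_le_smul_s11 {A B : Matrix n n ℝ} (hA : A.IsHermitian) (hB : B.PosDef) :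
    ∃ c : ℝ, 0 < c ∧ A ≤ c • B := by
  obtain ⟨a, ha, hAa⟩ := hA.exists_le_smul_one
  obtain ⟨b, hb, hBb⟩ := hB.inv.isHermitian.exists_le_smul_one
  refine ⟨a * b, by positivity, hAa.trans ?_⟩
  have h := hB.inv.inv_le_inv_s11 (PosDef.one.smul hb) hBb
  rw [nonsing_inv_nonsing_inv _ ((isUnit_iff_isUnit_det B).1 hB.isUnit),
    show (b • (1 : Matrix n n ℝ))⁻¹ = b⁻¹ • 1 from inv_eq_left_inv (by
      rw [smul_mul_smul_comm, inv_mul_cancel₀ hb.ne', one_smul, one_mul])] at h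
  have h' := PosSemidef.smul (le_iff.1 h) (mul_pos ha hb).le
  rwa [smul_sub, smul_smul, mul_assoc, mul_inv_cancel₀ hb.ne', mul_one] at h'

theorem PosDef.smul_inv {A : Matrix n n ℝ} (hA : A.PosDef) {c : ℝ} (hc : 0 < c) :
    (c • A)⁻¹ = c⁻¹ • A⁻¹ :=
  inv_eq_left_inv (by
    rw [smul_mul_smul_comm, inv_mul_cancel₀ hc.ne', one_smul,
      nonsing_inv_mul _ ((isUnit_iff_isUnit_det A).1 hA.isUnit)])

/-- A nonnegative, not identically zero combination of inverses of positive definite matrices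
plus a positive semidefinite term is positive definite. -/
theorem posDef_sum_smul_inv_add {ι : Type*} [Fintype ι] {w : ι → ℝ} (hw : ∀ j, 0 ≤ w j)
    {i : ι} (hi : 0 < w i) {P : ι → Matrix n n ℝ} (hP : ∀ j, (P j).PosDef)
    {S : Matrix n n ℝ} (hS : S.PosSemidef) : (∑ j, w j • (P j)⁻¹ + S).PosDef := by
  classical
  refine PosDef.add_posSemidef ?_ hS
  rw [← Finset.add_sum_erase _ _ (Finset.mem_univ i)]
  exact ((hP i).inv.smul hi).add_posSemidef
    (posSemidef_sum _ fun j _ ↦ (hP j).inv.posSemidef.smul (hw j))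

/-- Monotonicity and strict subhomogeneity of the Riccati map, combined. -/
theorem riccati_le_smul_sub {ι : Type*} [Fintype ι] (A : Matrix n n ℝ) {w : ι → ℝ}
    (hw : ∀ j, 0 ≤ w j) {i : ι} (hi : 0 < w i) {P₁ P₂ : ι → Matrix n n ℝ}
    (hP₁ : ∀ j, (P₁ j).PosDef) (hP₂ : ∀ j, (P₂ j).PosDef) {S₁ S₂ Q₁ Q₂ : Matrix n n ℝ}
    (hS₁ : S₁.PosSemidef) (hS : S₁ ≤ S₂) (hQ : Q₂ ≤ Q₁) {s : ℝ} (hs : 0 ≤ s)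
    (h : ∀ j, P₂ j ≤ (1 + s) • P₁ j) :
    A * (∑ j, w j • (P₂ j)⁻¹ + S₂)⁻¹ * Aᵀ + Q₂ ≤
      (1 + s) • (A * (∑ j, w j • (P₁ j)⁻¹ + S₁)⁻¹ * Aᵀ + Q₁) - s • Q₁ := by
  have ht : 0 < 1 + s := by linarith
  have hS₂ : S₂.PosSemidef := nonneg_iff_posSemidef.1 ((nonneg_iff_posSemidef.2 hS₁).trans hS)
  have hW₁ := posDef_sum_smul_inv_add hw hi hP₁ hS₁
  have hW₂ := posDef_sum_smul_inv_add hw hi hP₂ hS₂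
  have hW : (1 + s)⁻¹ • (∑ j, w j • (P₁ j)⁻¹ + S₁) ≤ ∑ j, w j • (P₂ j)⁻¹ + S₂ := by
    rw [smul_add, Finset.smul_sum]
    refine add_le_add (Finset.sum_le_sum fun j _ ↦ ?_) ?_
    · have := (hP₂ j).inv_le_inv_s11 ((hP₁ j).smul ht) (h j)
      rw [(hP₁ j).smul_inv ht] at this
      rw [smul_comm, le_iff, ← smul_sub]
      exact PosSemidef.smul (le_iff.1 this) (hw j)
    · refine le_trans ?_ hS
      simpa using smul_le_smul_of_nonneg_right_s11 hS₁ (inv_le_one_of_one_le₀ (by linarith : 1 ≤ 1 + s))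
  have hinv := (hW₁.smul (inv_pos.2 ht)).inv_le_inv_s11 hW₂ hW
  rw [hW₁.smul_inv (inv_pos.2 ht), inv_inv] at hinv
  have hcong := (le_iff.1 hinv).mul_mul_conjTranspose_same A
  rw [conjTranspose_eq_transpose_of_trivial, mul_sub, sub_mul, mul_smul_comm, smul_mul_assoc]
    at hcong
  have hsum := hcong.add (le_iff.1 hQ)
  rw [le_iff]
  convert hsum using 1
  rw [smul_add, add_smul, add_smul, one_smul]
  module

theorem le_of_forall_le_one_add_pow_smul {m : Type*} [Fintype m] {A B : Matrix m m ℝ}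
    (hA : A.IsHermitian) (hB : B.IsHermitian) {r s : ℝ} (hr₀ : 0 ≤ r) (hr₁ : r < 1)
    (h : ∀ k : ℕ, A ≤ (1 + r ^ k * s) • B) : A ≤ B := by
  refine .of_dotProduct_mulVec_nonneg (hB.sub hA) fun x ↦ ?_
  have hlim : Filter.Tendsto (fun k : ℕ ↦ star x ⬝ᵥ ((1 + r ^ k * s) • B - A) *ᵥ x)
      Filter.atTop (nhds (star x ⬝ᵥ (B - A) *ᵥ x)) := by
    have := (((tendsto_pow_atTop_nhds_zero_of_lt_one hr₀ hr₁).mul_const s).const_add 1).mul_const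
      (star x ⬝ᵥ B *ᵥ x) |>.sub_const (star x ⬝ᵥ A *ᵥ x)
    simpa [sub_mulVec, smul_mulVec, dotProduct_sub] using this
  exact ge_of_tendsto' hlim fun k ↦ (le_iff.1 (h k)).dotProduct_mulVec_nonneg x

/-- If the data of one system of coupled Riccati equations dominate those of another, then so do
the solutions. -/
theorem riccati_solution_le {ι : Type*} [Fintype ι] (A : Matrix n n ℝ) {L : Matrix ι ι ℝ}
    (hL : ∀ i j, 0 ≤ L i j) (hLdiag : ∀ i, 0 < L i i) {P₁ P₂ S₁ S₂ : ι → Matrix n n ℝ}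
    {Q₁ Q₂ : Matrix n n ℝ} (hP₁ : ∀ i, (P₁ i).PosDef) (hP₂ : ∀ i, (P₂ i).PosDef)
    (hS₁ : ∀ i, (S₁ i).PosSemidef) (hS : ∀ i, S₁ i ≤ S₂ i) (hQ₁ : Q₁.PosDef) (hQ : Q₂ ≤ Q₁)
    (heq₁ : ∀ i, P₁ i = A * (∑ j, L i j • (P₁ j)⁻¹ + S₁ i)⁻¹ * Aᵀ + Q₁)
    (heq₂ : ∀ i, P₂ i = A * (∑ j, L i j • (P₂ j)⁻¹ + S₂ i)⁻¹ * Aᵀ + Q₂) (i : ι) :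
    P₂ i ≤ P₁ i := by
  choose c hc hPQ using fun i ↦ PosDef.exists_le_smul_s11 (hP₁ i).isHermitian hQ₁
  choose d hd hPP using fun i ↦ PosDef.exists_le_smul_s11 (hP₂ i).isHermitian (hP₁ i)
  have hcsum : 0 ≤ ∑ i, c i := Finset.sum_nonneg fun i _ ↦ (hc i).le
  have hdsum : 0 ≤ ∑ i, d i := Finset.sum_nonneg fun i _ ↦ (hd i).le
  obtain ⟨ε, hε₀, hε₁, hεQ⟩ : ∃ ε : ℝ, 0 < ε ∧ ε ≤ 1 ∧ ∀ i, ε • P₁ i ≤ Q₁ := by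
    refine ⟨(1 + ∑ i, c i)⁻¹, by positivity, inv_le_one_of_one_le₀ (by linarith), fun i ↦ ?_⟩
    have h := (hPQ i).trans (smul_le_smul_of_nonneg_right_s11 hQ₁.posSemidef (b := 1 + ∑ i, c i)
      (by linarith [Finset.single_le_sum (fun j _ ↦ (hc j).le) (Finset.mem_univ i)]))
    have h' := PosSemidef.smul (le_iff.1 h) (by positivity : 0 ≤ (1 + ∑ i, c i)⁻¹)
    rwa [smul_sub, smul_smul, inv_mul_cancel₀ (by positivity), one_smul] at h'
  have hiter (k : ℕ) : ∀ i, P₂ i ≤ (1 + (1 - ε) ^ k * ∑ i, d i) • P₁ i := by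
    induction k with
    | zero =>
      intro i
      refine (hPP i).trans (smul_le_smul_of_nonneg_right_s11 (hP₁ i).posSemidef ?_)
      linarith [Finset.single_le_sum (fun j _ ↦ (hd j).le) (Finset.mem_univ i)]
    | succ k ih =>
      intro i
      have hs : 0 ≤ (1 - ε) ^ k * ∑ i, d i := mul_nonneg (pow_nonneg (by linarith) k) hdsum
      have h := riccati_le_smul_sub A (hL i) (hLdiag i) hP₁ hP₂ (hS₁ i) (hS i) hQ hs ih
      rw [← heq₁ i, ← heq₂ i] at h
      refine h.trans (le_iff.2 ?_)
      convert PosSemidef.smul (le_iff.1 (hεQ i)) hs using 1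
      rw [pow_succ]
      module
  exact le_of_forall_le_one_add_pow_smul (hP₂ i).isHermitian (hP₁ i).isHermitian
    (sub_nonneg.2 hε₁) (sub_lt_self 1 hε₀) fun k ↦ hiter k i

end Matrix

end Order

/-- under invertibility of `A`, collective observability, and the stated
conditions on the weight matrix `L`, positive definite solution families of the HCREs with
ordered data `Q_1 ≥ Q_2 > 0` and `R_{1,i} ≥ R_{2,i} > 0` satisfy `P_{1,i} ≥ P_{2,i}`
for every `i`. -/
theorem hcre_preserves_order {n N : ℕ}
    (A : Matrix (Fin n) (Fin n) ℝ) (hA : IsUnit A.det)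
    (m : Fin N → ℕ)
    (C : ∀ i, Matrix (Fin (m i)) (Fin n) ℝ)
    (hobs : ∀ x : Fin n → ℝ, (∀ i (k : ℕ), (C i).mulVec ((A ^ k).mulVec x) = 0) → x = 0)
    (L : Matrix (Fin N) (Fin N) ℝ) (hLsymm : L.IsSymm)
    (hLnonneg : ∀ i j, 0 ≤ L i j) (hLdiag : ∀ i, 0 < L i i)
    (hLrow : ∀ i, ∑ j, L i j = 1)
    (hLirr : ∀ i j, ∃ k : ℕ, 1 ≤ k ∧ 0 < (L ^ k) i j)
    (Q₁ Q₂ : Matrix (Fin n) (Fin n) ℝ) (hQ₁ : Q₁.PosDef) (hQ₂ : Q₂.PosDef)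
    (hQord : (Q₁ - Q₂).PosSemidef)
    (R₁ R₂ : ∀ i, Matrix (Fin (m i)) (Fin (m i)) ℝ)
    (hR₁ : ∀ i, (R₁ i).PosDef) (hR₂ : ∀ i, (R₂ i).PosDef)
    (hRord : ∀ i, (R₁ i - R₂ i).PosSemidef)
    (P₁ P₂ : Fin N → Matrix (Fin n) (Fin n) ℝ)
    (hP₁ : ∀ i, (P₁ i).PosDef) (hP₂ : ∀ i, (P₂ i).PosDef)
    (heq₁ : ∀ i, P₁ i = A * (∑ j, L i j • (P₁ j)⁻¹ + (C i)ᵀ * (R₁ i)⁻¹ * C i)⁻¹ * Aᵀ + Q₁)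
    (heq₂ : ∀ i, P₂ i = A * (∑ j, L i j • (P₂ j)⁻¹ + (C i)ᵀ * (R₂ i)⁻¹ * C i)⁻¹ * Aᵀ + Q₂) :
    ∀ i, (P₁ i - P₂ i).PosSemidef := by
  refine riccati_solution_le A hLnonneg hLdiag hP₁ hP₂ (fun i ↦ ?_) (fun i ↦ ?_) hQ₁ hQord heq₁ heq₂
  · simpa using (hR₁ i).inv.posSemidef.conjTranspose_mul_mul_same (C i)
  · have h := PosSemidef.conjTranspose_mul_mul_same
      (le_iff.1 ((hR₂ i).inv_le_inv_s11 (hR₁ i) (hRord i))) (C i)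
    rwa [conjTranspose_eq_transpose_of_trivial, Matrix.mul_sub, Matrix.sub_mul] at h
end

section
/- Let A ∈ ℝ^{n×n} be invertible, let C_i ∈ ℝ^{m_i×n} (i = 1, …, N) satisfy collective observability (the only x ∈ ℝ^n with C_i A^k x = 0 for all i and all integers k ≥ 0 is x = 0), let Q and R_i be positive definite, let L = [l_ij] be an N×N matrix that is symmetric, has nonnegative entries, positive diagonal entries, row sums equal to 1, and is irreducible, and let (P_1, …, P_N) be the unique positive definite solution of the HCRE P_i = A(∑_{j=1}^N l_ij P_j⁻¹ + C_iᵀ R_i⁻¹ C_i)⁻¹ Aᵀ + Q. Then for every ε > 0 there exists δ > 0 such that whenever R'_1, …, R'_N are symmetric matrices with ‖R'_i − R_i‖_F < δ for all i, each R'_i is positive definite and every family of positive definite solutions (P'_1, …, P'_N) of P'_i = A(∑_{j=1}^N l_ij P'_j⁻¹ + C_iᵀ (R'_i)⁻¹ C_i)⁻¹ Aᵀ + Q satisfies ‖P'_i − P_i‖_F < ε for all i. -/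
open Matrix

/-- The Frobenius norm of a real matrix. -/
noncomputable def frobNorm {a b : ℕ} (M : Matrix (Fin a) (Fin b) ℝ) : ℝ :=
  Real.sqrt (∑ i, ∑ j, (M i j) ^ 2)

namespace HCRE

open scoped MatrixOrder

/-- Inversion reverses the Loewner order on positive definite matrices. -/
lemma inv_le_inv_of_le {n : ℕ} {X Y : Matrix (Fin n) (Fin n) ℝ} (hX : X.PosDef) (hY : Y.PosDef)
    (h : Y ≤ X) : X⁻¹ ≤ Y⁻¹ := by
  have h₁ := hY.posSemidef.conjTranspose_mul_mul_same (Y⁻¹ - X⁻¹)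
  have h₂ := (Matrix.le_iff.1 h).conjTranspose_mul_mul_same X⁻¹
  have hXi : X⁻¹ᴴ = X⁻¹ := hX.inv.isHermitian
  have hYi : Y⁻¹ᴴ = Y⁻¹ := hY.inv.isHermitian
  have hXX : X⁻¹ * X = 1 := Matrix.nonsing_inv_mul _ ((Matrix.isUnit_iff_isUnit_det _).1 hX.isUnit)
  have hYY : Y⁻¹ * Y = 1 := Matrix.nonsing_inv_mul _ ((Matrix.isUnit_iff_isUnit_det _).1 hY.isUnit)
  have hYY' : Y * Y⁻¹ = 1 := Matrix.mul_nonsing_inv _ ((Matrix.isUnit_iff_isUnit_det _).1 hY.isUnit)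
  rw [conjTranspose_sub, hXi, hYi] at h₁
  rw [hXi] at h₂
  have key : Y⁻¹ - X⁻¹ = (Y⁻¹ - X⁻¹) * Y * (Y⁻¹ - X⁻¹) + X⁻¹ * (X - Y) * X⁻¹ := by
    simp only [Matrix.sub_mul, Matrix.mul_sub, hXX, hYY, Matrix.mul_assoc, hYY', Matrix.one_mul,
      Matrix.mul_one]
    abel
  rw [Matrix.le_iff, key]
  exact h₁.add h₂

lemma inv_smul_of_pos {n : ℕ} {X : Matrix (Fin n) (Fin n) ℝ} (hX : X.PosDef) {t : ℝ}
    (ht : 0 < t) : (t • X)⁻¹ = t⁻¹ • X⁻¹ :=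
  Matrix.inv_smul' X (Units.mk0 t ht.ne') ((Matrix.isUnit_iff_isUnit_det _).1 hX.isUnit)

lemma smul_le_smul_left {n : ℕ} {X Y : Matrix (Fin n) (Fin n) ℝ} (h : X ≤ Y) {t : ℝ}
    (ht : 0 ≤ t) : t • X ≤ t • Y := by
  rw [Matrix.le_iff, ← smul_sub]
  exact (Matrix.le_iff.1 h).smul ht

lemma smul_le_smul_right {n : ℕ} {X : Matrix (Fin n) (Fin n) ℝ} (hX : X.PosSemidef) {a b : ℝ}
    (h : a ≤ b) : a • X ≤ b • X := by
  rw [Matrix.le_iff, ← sub_smul]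
  exact hX.smul (sub_nonneg.2 h)

lemma inv_le_smul_inv {n : ℕ} {X Y : Matrix (Fin n) (Fin n) ℝ} (hX : X.PosDef) (hY : Y.PosDef)
    {t : ℝ} (ht : 0 < t) (h : X ≤ t • Y) : Y⁻¹ ≤ t • X⁻¹ := by
  have h₁ := smul_le_smul_left (inv_le_inv_of_le (hY.smul ht) hX h) ht.le
  rwa [inv_smul_of_pos hY ht, smul_smul, mul_inv_cancel₀ ht.ne', one_smul] at h₁

lemma conj_le_conj {k n : ℕ} {X Y : Matrix (Fin n) (Fin n) ℝ} (h : X ≤ Y)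
    (B : Matrix (Fin k) (Fin n) ℝ) : B * X * Bᵀ ≤ B * Y * Bᵀ := by
  have := (Matrix.le_iff.1 h).mul_mul_conjTranspose_same B
  rw [conjTranspose_eq_transpose_of_trivial] at this
  rw [Matrix.le_iff]
  convert this using 1
  rw [Matrix.mul_sub, Matrix.sub_mul]

/-- A Hermitian matrix is bounded by its Frobenius norm in the Loewner order. -/
lemma le_frobNorm_smul_one {n : ℕ} {M : Matrix (Fin n) (Fin n) ℝ} (hM : M.IsHermitian) :
    M ≤ frobNorm M • (1 : Matrix (Fin n) (Fin n) ℝ) := by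
  rw [Matrix.le_iff]
  refine .of_dotProduct_mulVec_nonneg ((isHermitian_one.smul (by simp [IsSelfAdjoint])).sub hM)
    fun x => ?_
  have hx : 0 ≤ ∑ i, x i ^ 2 := Finset.sum_nonneg fun i _ => sq_nonneg _
  have hq : star x ⬝ᵥ (M *ᵥ x) = ∑ p : Fin n × Fin n, M p.1 p.2 * (x p.1 * x p.2) := by
    rw [Fintype.sum_prod_type]
    simp only [dotProduct, mulVec, Finset.mul_sum, star_trivial]
    exact Finset.sum_congr rfl fun i _ => Finset.sum_congr rfl fun j _ => by ring
  have hcs := Finset.sum_mul_sq_le_sq_mul_sq Finset.univ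
    (fun p : Fin n × Fin n => M p.1 p.2) (fun p => x p.1 * x p.2)
  have hxx : ∑ p : Fin n × Fin n, (x p.1 * x p.2) ^ 2 = (∑ i, x i ^ 2) ^ 2 := by
    rw [Fintype.sum_prod_type, sq, Finset.sum_mul_sum]
    simp only [mul_pow]
  have hf : frobNorm M ^ 2 = ∑ p : Fin n × Fin n, M p.1 p.2 ^ 2 := by
    rw [Fintype.sum_prod_type, frobNorm, Real.sq_sqrt (by positivity)]
  rw [← hq, hxx, ← hf, ← mul_pow] at hcs
  have hle := abs_le_of_sq_le_sq' hcs (mul_nonneg (Real.sqrt_nonneg _) hx)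
  have h1 : star x ⬝ᵥ x = ∑ i, x i ^ 2 := by simp [dotProduct, sq]
  rw [sub_mulVec, smul_mulVec, one_mulVec, dotProduct_sub, dotProduct_smul, h1, smul_eq_mul]
  linarith [hle.2]

/-- A positive definite matrix dominates a positive multiple of the identity. -/
lemma exists_smul_one_le {n : ℕ} {X : Matrix (Fin n) (Fin n) ℝ} (hX : X.PosDef) :
    ∃ c : ℝ, 0 < c ∧ c • (1 : Matrix (Fin n) (Fin n) ℝ) ≤ X := by
  have hf : 0 ≤ frobNorm X⁻¹ := Real.sqrt_nonneg _
  have hf' : 0 < frobNorm X⁻¹ + 1 := by linarith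
  have h : X⁻¹ ≤ (frobNorm X⁻¹ + 1) • (1 : Matrix (Fin n) (Fin n) ℝ) :=
    (le_frobNorm_smul_one hX.inv.isHermitian).trans
      (smul_le_smul_right Matrix.PosSemidef.one (by linarith))
  have h' := inv_le_inv_of_le (Matrix.PosDef.one.smul hf') hX.inv h
  rw [inv_smul_of_pos Matrix.PosDef.one hf', inv_one,
    Matrix.nonsing_inv_nonsing_inv _ ((Matrix.isUnit_iff_isUnit_det _).1 hX.isUnit)] at h'
  exact ⟨_, inv_pos.2 hf', h'⟩

lemma exists_le_smul {n : ℕ} {M X : Matrix (Fin n) (Fin n) ℝ} (hM : M.IsHermitian)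
    (hX : X.PosDef) : ∃ t : ℝ, 0 < t ∧ M ≤ t • X := by
  obtain ⟨c, hc, hcX⟩ := exists_smul_one_le hX
  have hf : 0 ≤ frobNorm M := Real.sqrt_nonneg _
  refine ⟨(frobNorm M + 1) / c, by positivity, ?_⟩
  refine (le_frobNorm_smul_one hM).trans <|
    (smul_le_smul_right Matrix.PosSemidef.one (by linarith : frobNorm M ≤ frobNorm M + 1)).trans ?_
  have := smul_le_smul_left hcX (by positivity : 0 ≤ (frobNorm M + 1) / c)
  rwa [smul_smul, div_mul_cancel₀ _ hc.ne'] at this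

lemma exists_uniform_pos {k : ℕ} {p : Fin k → ℝ → Prop} (hp : ∀ i, ∃ c > 0, p i c)
    (hmono : ∀ i a b, 0 < a → a ≤ b → p i b → p i a) : ∃ c > 0, ∀ i, p i c := by
  choose c hc hpc using hp
  obtain ⟨ε, hε, h⟩ := Pi.exists_forall_pos_add_lt (x := fun _ : Fin k => (0 : ℝ)) (y := c) hc
  exact ⟨ε, hε, fun i => hmono i ε (c i) hε (by simpa using (h i).le) (hpc i)⟩

lemma le_smul_of_forall_gt {n : ℕ} {M X : Matrix (Fin n) (Fin n) ℝ} (hM : M.IsHermitian)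
    (hX : X.IsHermitian) {s : ℝ} (h : ∀ r > s, M ≤ r • X) : M ≤ s • X := by
  rw [Matrix.le_iff]
  refine .of_dotProduct_mulVec_nonneg ((hX.smul (by simp [IsSelfAdjoint])).sub hM) fun x => ?_
  have key : ∀ r > s, 0 ≤ r * (star x ⬝ᵥ (X *ᵥ x)) - star x ⬝ᵥ (M *ᵥ x) := fun r hr => by
    simpa [sub_mulVec, smul_mulVec, dotProduct_sub] using
      (Matrix.le_iff.1 (h r hr)).dotProduct_mulVec_nonneg x
  have hcont : Continuous fun r : ℝ => r * (star x ⬝ᵥ (X *ᵥ x)) - star x ⬝ᵥ (M *ᵥ x) := by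
    fun_prop
  have := ge_of_tendsto (hcont.continuousWithinAt (s := Set.Ioi s) (x := s))
    (Filter.eventually_of_mem self_mem_nhdsWithin key)
  simpa [sub_mulVec, smul_mulVec, dotProduct_sub] using this

lemma abs_apply_le_trace {n : ℕ} {X : Matrix (Fin n) (Fin n) ℝ} (hX : X.PosSemidef)
    (i j : Fin n) : |X i j| ≤ X.trace := by
  have hdiag : ∀ k, X k k ≤ X.trace := fun k =>
    Finset.single_le_sum (f := fun k => X k k) (fun l _ => hX.diag_nonneg) (Finset.mem_univ k)
  have hs : X j i = X i j := by simpa using hX.isHermitian.apply i j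
  have h₁ := hX.dotProduct_mulVec_nonneg (Pi.single i 1 + Pi.single j 1)
  have h₂ := hX.dotProduct_mulVec_nonneg (Pi.single i 1 - Pi.single j 1)
  simp [mulVec_add, mulVec_sub, add_dotProduct, sub_dotProduct, hs] at h₁ h₂
  rw [abs_le]
  constructor <;> linarith [hdiag i, hdiag j]

lemma frobNorm_le_of_abs_le {n : ℕ} {M : Matrix (Fin n) (Fin n) ℝ} {b : ℝ} (hb : 0 ≤ b)
    (h : ∀ i j, |M i j| ≤ b) : frobNorm M ≤ n * b := by
  refine Real.sqrt_le_iff.2 ⟨by positivity, ?_⟩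
  calc ∑ i, ∑ j, M i j ^ 2 ≤ ∑ _i : Fin n, ∑ _j : Fin n, b ^ 2 :=
        Finset.sum_le_sum fun i _ => Finset.sum_le_sum fun j _ =>
          sq_le_sq' (abs_le.1 (h i j)).1 (abs_le.1 (h i j)).2
    _ = (n * b) ^ 2 := by simp; ring

/-- Two-sided Loewner bounds control the Frobenius norm. -/
lemma frobNorm_le_of_le_of_le {n : ℕ} {M X : Matrix (Fin n) (Fin n) ℝ} (hX : X.PosSemidef)
    {η : ℝ} (hη : 0 ≤ η) (h₁ : M ≤ η • X) (h₂ : -M ≤ η • X) :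
    frobNorm M ≤ n * (η * X.trace) := by
  refine frobNorm_le_of_abs_le (mul_nonneg hη hX.trace_nonneg) fun i j => ?_
  have a₁ := abs_le.1 (abs_apply_le_trace (Matrix.le_iff.1 h₁) i j)
  have a₂ := abs_le.1 (abs_apply_le_trace (Matrix.le_iff.1 h₂) i j)
  simp [trace_sub, trace_smul, trace_add] at a₁ a₂
  rw [abs_le]
  constructor <;> linarith [a₁.1, a₁.2, a₂.1, a₂.2]

section Comparison

variable {n N : ℕ} {A Q : Matrix (Fin n) (Fin n) ℝ} {L : Matrix (Fin N) (Fin N) ℝ}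
  {P P' S S' : Fin N → Matrix (Fin n) (Fin n) ℝ}

lemma posDef_sum_smul_inv_add (hLnonneg : ∀ i j, 0 ≤ L i j) (hLdiag : ∀ i, 0 < L i i)
    (hP : ∀ i, (P i).PosDef) (hS : ∀ i, (S i).PosSemidef) (i : Fin N) :
    (∑ j, L i j • (P j)⁻¹ + S i).PosDef := by
  refine Matrix.PosDef.add_posSemidef ?_ (hS i)
  rw [← Finset.add_sum_erase _ _ (Finset.mem_univ i)]
  exact ((hP i).inv.smul (hLdiag i)).add_posSemidef
    (posSemidef_sum _ fun j _ => (hP j).inv.posSemidef.smul (hLnonneg i j))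

lemma riccati_step (hLnonneg : ∀ i j, 0 ≤ L i j) (hLdiag : ∀ i, 0 < L i i)
    (hP : ∀ i, (P i).PosDef) (hP' : ∀ i, (P' i).PosDef)
    (hS : ∀ i, (S i).PosSemidef) (hS' : ∀ i, (S' i).PosSemidef)
    (heq : ∀ i, P i = A * (∑ j, L i j • (P j)⁻¹ + S i)⁻¹ * Aᵀ + Q)
    (heq' : ∀ i, P' i = A * (∑ j, L i j • (P' j)⁻¹ + S' i)⁻¹ * Aᵀ + Q)
    {t : ℝ} (ht : 0 < t) (hSS : ∀ i, S i ≤ t • S' i) (h : ∀ i, P' i ≤ t • P i) (i : Fin N) :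
    P' i ≤ t • P i - (t - 1) • Q := by
  have hW : ∑ j, L i j • (P j)⁻¹ + S i ≤ t • (∑ j, L i j • (P' j)⁻¹ + S' i) := by
    rw [smul_add, Finset.smul_sum]
    refine add_le_add (Finset.sum_le_sum fun j _ => ?_) (hSS i)
    rw [smul_comm]
    exact smul_le_smul_left (inv_le_smul_inv (hP' j) (hP j) ht (h j)) (hLnonneg i j)
  have hWi := inv_le_smul_inv (posDef_sum_smul_inv_add hLnonneg hLdiag hP hS i)
    (posDef_sum_smul_inv_add hLnonneg hLdiag hP' hS' i) ht hW
  calc P' i = A * (∑ j, L i j • (P' j)⁻¹ + S' i)⁻¹ * Aᵀ + Q := heq' i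
    _ ≤ A * (t • (∑ j, L i j • (P j)⁻¹ + S i)⁻¹) * Aᵀ + Q := by
      gcongr ?_ + _
      exact conj_le_conj hWi A
    _ = t • (P i - Q) + Q := by
      rw [Matrix.mul_smul, Matrix.smul_mul, eq_sub_of_add_eq (heq i).symm]
    _ = t • P i - (t - 1) • Q := by
      rw [smul_sub, sub_smul, one_smul]; abel

/-- Comparison principle for the HCRE: enlarging the information terms by a factor `s ≥ 1`
changes the solution by at most the same factor. -/
lemma riccati_comparison (hLnonneg : ∀ i j, 0 ≤ L i j) (hLdiag : ∀ i, 0 < L i i)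
    (hQ : Q.PosDef) (hP : ∀ i, (P i).PosDef) (hP' : ∀ i, (P' i).PosDef)
    (hS : ∀ i, (S i).PosSemidef) (hS' : ∀ i, (S' i).PosSemidef)
    (heq : ∀ i, P i = A * (∑ j, L i j • (P j)⁻¹ + S i)⁻¹ * Aᵀ + Q)
    (heq' : ∀ i, P' i = A * (∑ j, L i j • (P' j)⁻¹ + S' i)⁻¹ * Aᵀ + Q)
    {s : ℝ} (hs : 1 ≤ s) (hSS : ∀ i, S i ≤ s • S' i) (i : Fin N) :
    P' i ≤ s • P i := by
  obtain ⟨c, hc, hcQ⟩ : ∃ c : ℝ, 0 < c ∧ ∀ i, c • P i ≤ Q := by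
    refine exists_uniform_pos (p := fun i c => c • P i ≤ Q) (fun i => ?_) fun i a b _ hab h =>
      (smul_le_smul_right (hP i).posSemidef hab).trans h
    obtain ⟨t, ht, h⟩ := exists_le_smul (hP i).isHermitian hQ
    refine ⟨t⁻¹, inv_pos.2 ht, ?_⟩
    have := smul_le_smul_left h (inv_pos.2 ht).le
    rwa [smul_smul, inv_mul_cancel₀ ht.ne', one_smul] at this
  obtain ⟨t₁, ht₁, hlt⟩ : ∃ t, s ≤ t ∧ ∀ i, P' i ≤ t • P i := by
    choose t _ h using fun i => exists_le_smul (hP' i).isHermitian (hP i)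
    obtain ⟨b, hb⟩ := (Set.finite_range t).bddAbove
    exact ⟨max s b, le_max_left _ _, fun i => (h i).trans (smul_le_smul_right (hP i).posSemidef
      ((hb ⟨i, rfl⟩).trans (le_max_right _ _)))⟩
  set T : Set ℝ := {t | s ≤ t ∧ ∀ i, P' i ≤ t • P i}
  have hTne : T.Nonempty := ⟨t₁, ht₁, hlt⟩
  have hTbdd : BddBelow T := ⟨s, fun t ht => ht.1⟩
  have hmem : sInf T ∈ T := by
    refine ⟨le_csInf hTne fun t ht => ht.1, fun i =>
      le_smul_of_forall_gt (hP' i).isHermitian (hP i).isHermitian fun r hr => ?_⟩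
    obtain ⟨t, ht, htr⟩ := exists_lt_of_csInf_lt hTne hr
    exact (ht.2 i).trans (smul_le_smul_right (hP i).posSemidef htr.le)
  have hstep : max s (sInf T - (sInf T - 1) * c) ∈ T := by
    have h1 : 1 ≤ sInf T := hs.trans hmem.1
    refine ⟨le_max_left _ _, fun i => ?_⟩
    have hSS' : ∀ i, S i ≤ sInf T • S' i := fun i =>
      (hSS i).trans (smul_le_smul_right (hS' i) hmem.1)
    refine (riccati_step hLnonneg hLdiag hP hP' hS hS' heq heq' (by linarith) hSS' hmem.2 i).trans
      (le_trans ?_ (smul_le_smul_right (hP i).posSemidef (le_max_right _ _)))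
    rw [sub_smul _ _ (P i), mul_smul]
    exact sub_le_sub_left (smul_le_smul_left (hcQ i) (by linarith)) _
  have hTs : sInf T ≤ s := by
    rcases le_max_iff.1 (csInf_le hTbdd hstep) with h | h
    · exact h
    · nlinarith [mul_nonneg (sub_nonneg.2 (hs.trans hmem.1)) hc.le]
  exact (hmem.2 i).trans (smul_le_smul_right (hP i).posSemidef hTs)

end Comparison

lemma information_le {k n : ℕ} {X Y : Matrix (Fin k) (Fin k) ℝ} (hX : X.PosDef) (hY : Y.PosDef)
    (C : Matrix (Fin k) (Fin n) ℝ) {s : ℝ} (hs : 0 < s) (h : X ≤ s • Y) :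
    Cᵀ * Y⁻¹ * C ≤ s • (Cᵀ * X⁻¹ * C) := by
  have := conj_le_conj (inv_le_smul_inv hX hY hs h) Cᵀ
  rwa [transpose_transpose, Matrix.mul_smul, Matrix.smul_mul] at this

lemma information_posSemidef {k n : ℕ} {X : Matrix (Fin k) (Fin k) ℝ} (hX : X.PosDef)
    (C : Matrix (Fin k) (Fin n) ℝ) : (Cᵀ * X⁻¹ * C).PosSemidef := by
  simpa using hX.inv.posSemidef.conjTranspose_mul_mul_same C

lemma frobNorm_neg {a b : ℕ} (M : Matrix (Fin a) (Fin b) ℝ) : frobNorm (-M) = frobNorm M := by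
  simp [frobNorm]

/-- Matrices close to a positive definite matrix are multiplicatively close to it. -/
lemma exists_pos_forall_frobNorm_sub_lt {k : ℕ} {X : Matrix (Fin k) (Fin k) ℝ} (hX : X.PosDef)
    {s : ℝ} (hs : 1 < s) : ∃ δ > 0, ∀ Y : Matrix (Fin k) (Fin k) ℝ, Y.IsSymm →
      frobNorm (Y - X) < δ → Y.PosDef ∧ X ≤ s • Y ∧ Y ≤ s • X := by
  obtain ⟨c, hc, hcX⟩ := exists_smul_one_le hX
  have hs0 : 0 < s := by linarith
  have hs1 : s⁻¹ < 1 := inv_lt_one_of_one_lt₀ hs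
  refine ⟨(1 - s⁻¹) * c, mul_pos (by linarith) hc, fun Y hY hd => ?_⟩
  have hYH : Y.IsHermitian := by
    rwa [Matrix.IsHermitian, conjTranspose_eq_transpose_of_trivial]
  have bound : ∀ M : Matrix (Fin k) (Fin k) ℝ, M.IsHermitian → frobNorm M < (1 - s⁻¹) * c →
      M ≤ (1 - s⁻¹) • X := fun M hM hlt => by
    refine (le_frobNorm_smul_one hM).trans <|
      (smul_le_smul_right Matrix.PosSemidef.one hlt.le).trans ?_
    rw [mul_smul]
    exact smul_le_smul_left hcX (by linarith)
  have hup := bound _ (hYH.sub hX.isHermitian) hd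
  have hlo := bound _ (hYH.sub hX.isHermitian).neg (by rwa [frobNorm_neg])
  have hlow : s⁻¹ • X ≤ Y := by
    rw [Matrix.le_iff] at hlo ⊢
    convert hlo using 1
    rw [sub_smul, one_smul]; abel
  refine ⟨?_, ?_, ?_⟩
  · have := (hX.smul (inv_pos.2 hs0)).add_posSemidef (Matrix.le_iff.1 hlow)
    rwa [add_sub_cancel] at this
  · have := smul_le_smul_left hlow hs0.le
    rwa [smul_smul, mul_inv_cancel₀ hs0.ne', one_smul] at this
  · have h2 : Y ≤ (2 - s⁻¹) • X := by
      rw [Matrix.le_iff] at hup ⊢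
      convert hup using 1
      rw [sub_smul, sub_smul, one_smul, two_smul]; abel
    refine h2.trans (smul_le_smul_right hX.posSemidef ?_)
    have : s * s⁻¹ = 1 := mul_inv_cancel₀ hs0.ne'
    nlinarith

lemma frobNorm_sub_le {n : ℕ} {X Y : Matrix (Fin n) (Fin n) ℝ} (hX : X.PosDef) {s : ℝ}
    (hs : 1 ≤ s) (h₁ : Y ≤ s • X) (h₂ : X ≤ s • Y) :
    frobNorm (Y - X) ≤ n * ((s - 1) * X.trace) := by
  have hs0 : 0 < s := by linarith
  refine frobNorm_le_of_le_of_le hX.posSemidef (by linarith) ?_ ?_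
  · rw [sub_smul, one_smul]
    exact sub_le_sub_right h₁ X
  · have h := smul_le_smul_left h₂ (inv_pos.2 hs0).le
    rw [smul_smul, inv_mul_cancel₀ hs0.ne', one_smul] at h
    rw [neg_sub]
    refine (sub_le_sub_left h X).trans ?_
    have : X - s⁻¹ • X = (1 - s⁻¹) • X := by rw [sub_smul, one_smul]
    rw [this]
    refine smul_le_smul_right hX.posSemidef ?_
    have : s * s⁻¹ = 1 := mul_inv_cancel₀ hs0.ne'
    nlinarith

end HCRE

/-- the unique positive definite solution family of the HCRE depends
continuously on the measurement covariances `R_i` (in Frobenius norm). -/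
theorem hcre_continuous_in_R {n N : ℕ}
    (A : Matrix (Fin n) (Fin n) ℝ) (hA : IsUnit A.det)
    (m : Fin N → ℕ)
    (C : ∀ i, Matrix (Fin (m i)) (Fin n) ℝ)
    (hobs : ∀ x : Fin n → ℝ, (∀ i (k : ℕ), (C i).mulVec ((A ^ k).mulVec x) = 0) → x = 0)
    (Q : Matrix (Fin n) (Fin n) ℝ) (hQ : Q.PosDef)
    (R : ∀ i, Matrix (Fin (m i)) (Fin (m i)) ℝ) (hR : ∀ i, (R i).PosDef)
    (L : Matrix (Fin N) (Fin N) ℝ) (hLsymm : L.IsSymm)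
    (hLnonneg : ∀ i j, 0 ≤ L i j) (hLdiag : ∀ i, 0 < L i i)
    (hLrow : ∀ i, ∑ j, L i j = 1)
    (hLirr : ∀ i j, ∃ k : ℕ, 1 ≤ k ∧ 0 < (L ^ k) i j)
    (P : Fin N → Matrix (Fin n) (Fin n) ℝ) (hP : ∀ i, (P i).PosDef)
    (heq : ∀ i, P i = A * (∑ j, L i j • (P j)⁻¹ + (C i)ᵀ * (R i)⁻¹ * C i)⁻¹ * Aᵀ + Q) :
    ∀ ε > (0 : ℝ), ∃ δ > (0 : ℝ),
      ∀ R' : ∀ i, Matrix (Fin (m i)) (Fin (m i)) ℝ,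
        (∀ i, (R' i).IsSymm) → (∀ i, frobNorm (R' i - R i) < δ) →
        (∀ i, (R' i).PosDef) ∧
        ∀ P' : Fin N → Matrix (Fin n) (Fin n) ℝ, (∀ i, (P' i).PosDef) →
          (∀ i, P' i = A * (∑ j, L i j • (P' j)⁻¹ + (C i)ᵀ * (R' i)⁻¹ * C i)⁻¹ * Aᵀ + Q) →
          ∀ i, frobNorm (P' i - P i) < ε := by
  intro ε hε
  have htr : ∀ i, 0 ≤ (P i).trace := fun i => (hP i).posSemidef.trace_nonneg
  have hT : 0 ≤ ∑ i, (P i).trace := Finset.sum_nonneg fun i _ => htr i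
  set K : ℝ := n * ∑ i, (P i).trace
  have hK0 : 0 ≤ K := by positivity
  set η : ℝ := ε / (K + 1)
  have hη0 : 0 < η := by positivity
  have hs : 1 < 1 + η := by linarith
  obtain ⟨δ, hδ, hclose⟩ := HCRE.exists_uniform_pos
    (fun i => HCRE.exists_pos_forall_frobNorm_sub_lt (hR i) hs)
    fun i a b _ hab h Y hY hlt => h Y hY (hlt.trans_le hab)
  refine ⟨δ, hδ, fun R' hsymm hlt => ?_⟩
  have hR' : ∀ i, (R' i).PosDef := fun i => (hclose i _ (hsymm i) (hlt i)).1
  refine ⟨hR', fun P' hP' heq' i => ?_⟩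
  have hS := fun i => HCRE.information_posSemidef (hR i) (C i)
  have hS' := fun i => HCRE.information_posSemidef (hR' i) (C i)
  have hs0 : 0 < 1 + η := by linarith
  have hup := HCRE.riccati_comparison hLnonneg hLdiag hQ hP hP' hS hS' heq heq' hs.le
    (fun i => HCRE.information_le (hR' i) (hR i) (C i) hs0
      (hclose i _ (hsymm i) (hlt i)).2.2) i
  have hlo := HCRE.riccati_comparison hLnonneg hLdiag hQ hP' hP hS' hS heq' heq hs.le
    (fun i => HCRE.information_le (hR i) (hR' i) (C i) hs0
      (hclose i _ (hsymm i) (hlt i)).2.1) i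
  calc frobNorm (P' i - P i) ≤ n * ((1 + η - 1) * (P i).trace) :=
        HCRE.frobNorm_sub_le (hP i) hs.le hup hlo
    _ = η * (n * (P i).trace) := by ring
    _ ≤ η * K := by
      refine mul_le_mul_of_nonneg_left (mul_le_mul_of_nonneg_left ?_ n.cast_nonneg) hη0.le
      exact Finset.single_le_sum (f := fun i => (P i).trace) (fun j _ => htr j)
        (Finset.mem_univ i)
    _ < η * (K + 1) := by gcongr; linarith
    _ = ε := div_mul_cancel₀ _ (by positivity)
end

section
/- Let A ∈ ℝ^{n×n} be invertible, let C_i ∈ ℝ^{m_i×n} (i = 1, …, N) satisfy collective observability (the only x ∈ ℝ^n with C_i A^k x = 0 for all i and all integers k ≥ 0 is x = 0), let Q be positive definite, let L = [l_ij] be an N×N matrix that is symmetric, has nonnegative entries, positive diagonal entries, row sums equal to 1, and is irreducible, and for each i let R_{i,k} (k ≥ 0) be a sequence of positive definite m_i×m_i matrices converging to a positive definite matrix R_i. Then for any positive definite initial values P_{i,0}, the iterates of the recursion P_{i,k+1} = A(∑_{j=1}^N l_ij P_{j,k}⁻¹ + C_iᵀ R_{i,k}⁻¹ C_i)⁻¹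 Aᵀ + Q converge, for each i, to the i-th component of the unique positive definite solution family of the HCRE P_i = A(∑_{j=1}^N l_ij P_j⁻¹ + C_iᵀ R_i⁻¹ C_i)⁻¹ Aᵀ + Q. -/
open Matrix Filter

namespace Matrix

variable {ι : Type*}

/-- Positive definiteness is an open condition among real symmetric matrices. -/
theorem PosDef.eventually_of_tendsto [Fintype ι] {α : Type*} {l : Filter α} {F : α → Matrix ι ι ℝ}
    {M : Matrix ι ι ℝ} (hM : M.PosDef) (hF : Tendsto F l (nhds M))
    (hherm : ∀ a, (F a).IsHermitian) : ∀ᶠ a in l, (F a).PosDef := by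
  have hopen : ∀ᶠ X in nhds M, ∀ x ∈ Metric.sphere (0 : ι → ℝ) 1, 0 < x ⬝ᵥ X *ᵥ x := by
    refine (isCompact_sphere _ _).eventually_forall_of_forall_eventually fun x hx => ?_
    have hcont : Continuous fun z : Matrix ι ι ℝ × (ι → ℝ) => z.2 ⬝ᵥ z.1 *ᵥ z.2 := by fun_prop
    have hx0 : x ≠ 0 := by
      rintro rfl
      simp at hx
    have hpos : 0 < x ⬝ᵥ M *ᵥ x := by simpa using hM.dotProduct_mulVec_pos hx0
    exact hcont.continuousAt.eventually (lt_mem_nhds hpos)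
  filter_upwards [hF.eventually hopen] with a ha
  refine .of_dotProduct_mulVec_pos (hherm a) fun x hx => ?_
  have hnorm : 0 < ‖x‖ := norm_pos_iff.mpr hx
  have hscaled := ha (‖x‖⁻¹ • x) (by simp [norm_smul, hnorm.ne'])
  rw [mulVec_smul, dotProduct_smul, smul_dotProduct, smul_eq_mul, smul_eq_mul] at hscaled
  simpa [hnorm] using hscaled

/-- Two matrices are within the multiplicative factor `1 + a` of each other in the Loewner
order. -/
def LoewnerClose (a : ℝ) (X Y : Matrix ι ι ℝ) : Prop :=
  ((1 + a) • X - Y).PosSemidef ∧ ((1 + a) • Y - X).PosSemidef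

namespace LoewnerClose

variable {X Y : Matrix ι ι ℝ} {a b : ℝ}

theorem mono (h : LoewnerClose a X Y) (hX : X.PosSemidef) (hY : Y.PosSemidef) (hab : a ≤ b) :
    LoewnerClose b X Y := by
  constructor
  · convert h.1.add (hX.smul (sub_nonneg.mpr hab)) using 1
    module
  · convert h.2.add (hY.smul (sub_nonneg.mpr hab)) using 1
    module

theorem add {X' Y' : Matrix ι ι ℝ} (h : LoewnerClose a X Y) (h' : LoewnerClose a X' Y') :
    LoewnerClose a (X + X') (Y + Y') := by
  constructor
  · convert h.1.add h'.1 using 1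
    module
  · convert h.2.add h'.2 using 1
    module

theorem smul {c : ℝ} (hc : 0 ≤ c) (h : LoewnerClose a X Y) :
    LoewnerClose a (c • X) (c • Y) := by
  constructor
  · convert h.1.smul hc using 1
    module
  · convert h.2.smul hc using 1
    module

theorem zero : LoewnerClose a (0 : Matrix ι ι ℝ) 0 := by
  constructor <;> simpa using PosSemidef.zero

theorem sum {κ : Type*} {X Y : κ → Matrix ι ι ℝ} (s : Finset κ)
    (h : ∀ j ∈ s, LoewnerClose a (X j) (Y j)) :
    LoewnerClose a (∑ j ∈ s, X j) (∑ j ∈ s, Y j) := by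
  classical
  induction s using Finset.induction_on with
  | empty => simpa using zero
  | insert j s hj ih =>
    rw [Finset.sum_insert hj, Finset.sum_insert hj]
    exact (h j (Finset.mem_insert_self j s)).add
      (ih fun i hi => h i (Finset.mem_insert_of_mem hi))

theorem mul_mul_transpose [Fintype ι] {κ : Type*} [Fintype κ] (h : LoewnerClose a X Y)
    (B : Matrix κ ι ℝ) :
    LoewnerClose a (B * X * Bᵀ) (B * Y * Bᵀ) := by
  constructor
  · simpa [Matrix.mul_sub, Matrix.sub_mul] using h.1.mul_mul_conjTranspose_same B
  · simpa [Matrix.mul_sub, Matrix.sub_mul] using h.2.mul_mul_conjTranspose_same B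

end LoewnerClose

/-- Inversion of positive definite matrices reverses the Loewner order. -/
theorem PosDef.posSemidef_inv_sub_inv [Fintype ι] [DecidableEq ι] {X Y : Matrix ι ι ℝ}
    (hX : X.PosDef)
    (hY : Y.PosDef) (h : (Y - X).PosSemidef) : (X⁻¹ - Y⁻¹).PosSemidef := by
  have := hX.inv.isUnit.invertible
  have := hY.isUnit.invertible
  have hdet : IsUnit X.det := (isUnit_iff_isUnit_det X).mp hX.isUnit
  have h₁ := PosDef.fromBlocks₁₁ (1 : Matrix ι ι ℝ) Y hX.inv
  have h₂ := PosDef.fromBlocks₂₂ X⁻¹ (1 : Matrix ι ι ℝ) hY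
  simp only [conjTranspose_one, one_mul, mul_one, nonsing_inv_nonsing_inv X hdet] at h₁ h₂
  exact h₂.mp (h₁.mpr h)

theorem PosDef.posSemidef_smul_inv_sub_inv [Fintype ι] [DecidableEq ι] {X Y : Matrix ι ι ℝ}
    (hX : X.PosDef)
    (hY : Y.PosDef) {c : ℝ} (hc : 0 < c) (h : (c • X - Y).PosSemidef) :
    (c • Y⁻¹ - X⁻¹).PosSemidef := by
  have hinv := (hY.posSemidef_inv_sub_inv (hX.smul hc) h).smul hc.le
  have hunit : IsUnit X.det := (isUnit_iff_isUnit_det X).mp hX.isUnit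
  have : (c • X)⁻¹ = c⁻¹ • X⁻¹ := by
    simpa [Units.smul_def] using inv_smul' X (Units.mk0 c hc.ne') hunit
  rwa [this, smul_sub, smul_smul, mul_inv_cancel₀ hc.ne', one_smul] at hinv

theorem LoewnerClose.inv [Fintype ι] [DecidableEq ι] {X Y : Matrix ι ι ℝ} {a : ℝ}
    (h : LoewnerClose a X Y)
    (hX : X.PosDef) (hY : Y.PosDef) (ha : 0 ≤ a) : LoewnerClose a X⁻¹ Y⁻¹ :=
  ⟨hY.posSemidef_smul_inv_sub_inv hX (by linarith) h.2,
    hX.posSemidef_smul_inv_sub_inv hY (by linarith) h.1⟩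

/-- Adding a common matrix `Q` strictly improves multiplicative closeness as soon as `Q`
dominates a multiple of one of the two sums. -/
theorem LoewnerClose.add_right_contract {X Y Q : Matrix ι ι ℝ} {a ε : ℝ}
    (h : LoewnerClose a X Y) (ha : 0 ≤ a) (hε : 0 ≤ ε) (hε1 : ε ≤ 1)
    (hYQ : (Y + Q).PosSemidef) (hQ : (Q - ε • (Y + Q)).PosSemidef) :
    LoewnerClose ((1 - ε) * a) (X + Q) (Y + Q) := by
  have ha' : 0 < 1 + a := by linarith
  constructor
  · have hscale : 0 ≤ (1 + (1 - ε) * a) / (1 + a) := by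
      have := mul_nonneg (sub_nonneg.mpr hε1) ha
      positivity
    have hrem : 0 ≤ (1 - ε) * ε * a ^ 2 / (1 + a) := by
      have := sub_nonneg.mpr hε1
      positivity
    convert ((h.1.smul hscale).add ((hQ.smul ha).smul hscale)).add (hYQ.smul hrem) using 1
    match_scalars <;> field_simp <;> ring
  · convert h.2.add (hQ.smul ha) using 1
    module

theorem LoewnerClose.eventually_atTop [Fintype ι] {X Y : Matrix ι ι ℝ}
    (hX : X.PosDef) (hY : Y.PosDef) :
    ∀ᶠ a : ℝ in atTop, LoewnerClose a X Y := by
  have hside : ∀ {U V : Matrix ι ι ℝ}, U.PosDef → V.PosDef →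
      ∀ᶠ a : ℝ in atTop, ((1 + a) • U - V).PosSemidef := by
    intro U V hU hV
    have hlim : Tendsto (fun a : ℝ => U - (1 + a)⁻¹ • V) atTop (nhds U) := by
      have := (tendsto_inv_atTop_zero.comp
        (tendsto_atTop_add_const_left atTop (1 : ℝ) tendsto_id)).smul_const V
      simpa using tendsto_const_nhds.sub this
    have hev := hU.eventually_of_tendsto hlim fun a =>
      hU.1.sub (hV.1.smul (IsSelfAdjoint.all _))
    filter_upwards [hev, eventually_ge_atTop 0] with a ha ha0
    have ha1 : 0 < 1 + a := by linarith
    convert ha.posSemidef.smul ha1.le using 1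
    rw [smul_sub, smul_smul, mul_inv_cancel₀ ha1.ne', one_smul]
  exact (hside hX hY).and (hside hY hX)

theorem LoewnerClose.eventually_of_tendsto [Fintype ι] {α : Type*} {l : Filter α}
    {F : α → Matrix ι ι ℝ}
    {M : Matrix ι ι ℝ} (hM : M.PosDef) (hF : Tendsto F l (nhds M))
    (hherm : ∀ i, (F i).IsHermitian) {a : ℝ} (ha : 0 < a) :
    ∀ᶠ i in l, LoewnerClose a (F i) M := by
  have hlim₁ : Tendsto (fun i => (1 + a) • F i - M) l (nhds (a • M)) := by
    convert (hF.const_smul (1 + a)).sub_const M using 2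
    module
  have hlim₂ : Tendsto (fun i => (1 + a) • M - F i) l (nhds (a • M)) := by
    convert hF.const_sub ((1 + a) • M) using 2
    module
  filter_upwards [(hM.smul ha).eventually_of_tendsto hlim₁ fun i =>
      ((hherm i).smul (IsSelfAdjoint.all _)).sub hM.1,
    (hM.smul ha).eventually_of_tendsto hlim₂ fun i =>
      (hM.1.smul (IsSelfAdjoint.all _)).sub (hherm i)] with i h₁ h₂
  exact ⟨h₁.posSemidef, h₂.posSemidef⟩

/-- Convergence in the multiplicative Loewner sense implies convergence. -/
theorem tendsto_of_eventually_loewnerClose [Fintype ι] [DecidableEq ι] {α : Type*} {l : Filter α}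
    {F : α → Matrix ι ι ℝ} {M : Matrix ι ι ℝ} (hM : M.PosSemidef)
    (hherm : ∀ i, (F i).IsHermitian)
    (h : ∀ a : ℝ, 0 < a → ∀ᶠ i in l, LoewnerClose a (F i) M) : Tendsto F l (nhds M) := by
  have hquad : ∀ x : ι → ℝ, Tendsto (fun i => x ⬝ᵥ F i *ᵥ x) l (nhds (x ⬝ᵥ M *ᵥ x)) := by
    intro x
    have hq : 0 ≤ x ⬝ᵥ M *ᵥ x := by simpa using hM.dotProduct_mulVec_nonneg x
    refine Metric.tendsto_nhds.mpr fun ε hε => ?_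
    set q := x ⬝ᵥ M *ᵥ x
    have hδ : 0 < ε / (q + 1) := by positivity
    have hδq : ε / (q + 1) * q < ε := by
      rw [div_mul_eq_mul_div, div_lt_iff₀ (by positivity)]
      nlinarith
    filter_upwards [h _ hδ] with i hi
    have h₁ := hi.1.dotProduct_mulVec_nonneg x
    have h₂ := hi.2.dotProduct_mulVec_nonneg x
    simp only [star_trivial, sub_mulVec, smul_mulVec, dotProduct_sub, dotProduct_smul,
      smul_eq_mul] at h₁ h₂
    rw [Real.dist_eq, abs_lt]
    constructor <;> nlinarith
  have hpolar : ∀ {S : Matrix ι ι ℝ}, S.IsHermitian → ∀ i j, S i j =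
      ((Pi.single i 1 + Pi.single j 1) ⬝ᵥ S *ᵥ (Pi.single i 1 + Pi.single j 1) -
        Pi.single i 1 ⬝ᵥ S *ᵥ Pi.single i 1 - Pi.single j 1 ⬝ᵥ S *ᵥ Pi.single j 1) / 2 := by
    intro S hS i j
    have hsymm : S j i = S i j := by simpa using hS.apply i j
    simp only [mulVec_add, add_dotProduct, dotProduct_add, mulVec_single_one,
      single_one_dotProduct, col_apply, hsymm]
    ring
  refine tendsto_pi_nhds.mpr fun i => tendsto_pi_nhds.mpr fun j => ?_
  rw [hpolar hM.1 i j]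
  simp_rw [fun k => hpolar (hherm k) i j]
  exact (((hquad _).sub (hquad _)).sub (hquad _)).div_const 2

theorem PosDef.sum_smul_add {κ : Type*} [Fintype κ] {w : κ → ℝ} {X : κ → Matrix ι ι ℝ}
    {S : Matrix ι ι ℝ} (hw : ∀ j, 0 ≤ w j) {i : κ} (hi : 0 < w i) (hX : ∀ j, (X j).PosDef)
    (hS : S.PosSemidef) : (∑ j, w j • X j + S).PosDef := by
  classical
  rw [← Finset.add_sum_erase _ _ (Finset.mem_univ i), add_assoc]
  exact ((hX i).smul hi).add_posSemidef
    ((posSemidef_sum _ fun j _ => (hX j).posSemidef.smul (hw j)).add hS)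

theorem PosDef.tendsto_inv [Fintype ι] [DecidableEq ι] {α : Type*} {l : Filter α}
    {F : α → Matrix ι ι ℝ}
    {M : Matrix ι ι ℝ} (hM : M.PosDef) (hF : Tendsto F l (nhds M)) :
    Tendsto (fun i => (F i)⁻¹) l (nhds M⁻¹) := by
  refine (continuousAt_matrix_inv M ?_).tendsto.comp hF
  rw [Ring.inverse_eq_inv']
  exact continuousAt_inv₀ hM.det_pos.ne'

end Matrix

/-- under invertibility of `A`, collective observability, positive definite `Q`,
the stated conditions on `L`, and positive definite `R_{i,k} → R_i` with `R_i` positive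
definite, the recursion `P_{i,k+1} = A(∑_j l_ij P_{j,k}⁻¹ + C_iᵀ R_{i,k}⁻¹ C_i)⁻¹ Aᵀ + Q`
converges, from any positive definite initial values, to the unique positive definite solution
family of the HCRE `P_i = A(∑_j l_ij P_j⁻¹ + C_iᵀ R_i⁻¹ C_i)⁻¹ Aᵀ + Q`. -/
theorem hcrr_convergent_parameter {n N : ℕ}
    (A : Matrix (Fin n) (Fin n) ℝ) (hA : IsUnit A.det)
    (m : Fin N → ℕ)
    (C : ∀ i, Matrix (Fin (m i)) (Fin n) ℝ)
    (hobs : ∀ x : Fin n → ℝ, (∀ i (k : ℕ), (C i).mulVec ((A ^ k).mulVec x) = 0) → x = 0)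
    (Q : Matrix (Fin n) (Fin n) ℝ) (hQ : Q.PosDef)
    (L : Matrix (Fin N) (Fin N) ℝ) (hLsymm : L.IsSymm)
    (hLnonneg : ∀ i j, 0 ≤ L i j) (hLdiag : ∀ i, 0 < L i i)
    (hLrow : ∀ i, ∑ j, L i j = 1)
    (hLirr : ∀ i j, ∃ k : ℕ, 1 ≤ k ∧ 0 < (L ^ k) i j)
    (R : ∀ i, ℕ → Matrix (Fin (m i)) (Fin (m i)) ℝ) (hRk : ∀ i k, (R i k).PosDef)
    (Rlim : ∀ i, Matrix (Fin (m i)) (Fin (m i)) ℝ) (hRlim : ∀ i, (Rlim i).PosDef)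
    (hRconv : ∀ i, Tendsto (R i) atTop (nhds (Rlim i)))
    (Pseq : ℕ → Fin N → Matrix (Fin n) (Fin n) ℝ)
    (hP0 : ∀ i, (Pseq 0 i).PosDef)
    (hrec : ∀ k i, Pseq (k + 1) i =
      A * (∑ j, L i j • (Pseq k j)⁻¹ + (C i)ᵀ * (R i k)⁻¹ * C i)⁻¹ * Aᵀ + Q)
    (P : Fin N → Matrix (Fin n) (Fin n) ℝ) (hP : ∀ i, (P i).PosDef)
    (heq : ∀ i, P i = A * (∑ j, L i j • (P j)⁻¹ + (C i)ᵀ * (Rlim i)⁻¹ * C i)⁻¹ * Aᵀ + Q) :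
    ∀ i, Tendsto (fun k => Pseq k i) atTop (nhds (P i)) := by
  have hS : ∀ i {T : Matrix (Fin (m i)) (Fin (m i)) ℝ}, T.PosDef →
      ((C i)ᵀ * T⁻¹ * C i).PosSemidef := fun i T hT => by
    simpa using hT.inv.posSemidef.conjTranspose_mul_mul_same (C i)
  have hPseq : ∀ k i, (Pseq k i).PosDef := by
    intro k
    induction k with
    | zero => exact hP0
    | succ k ih =>
      intro i
      have hM := PosDef.sum_smul_add (hLnonneg i) (hLdiag i) (fun j => (ih j).inv)
        (hS i (hRk i k))
      rw [hrec]
      exact hQ.posSemidef_add (by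
        simpa using hM.inv.posSemidef.mul_mul_conjTranspose_same A)
  obtain ⟨ε, hε, hε1, hεQ⟩ : ∃ ε : ℝ, 0 < ε ∧ ε ≤ 1 ∧ ∀ i, (Q - ε • P i).PosSemidef := by
    obtain ⟨b, hb, hb0⟩ := ((eventually_all.mpr fun i =>
      LoewnerClose.eventually_atTop hQ (hP i)).and (eventually_ge_atTop (0 : ℝ))).exists
    have hb1 : 0 < 1 + b := by linarith
    refine ⟨(1 + b)⁻¹, by positivity, inv_le_one_of_one_le₀ (by linarith), fun i => ?_⟩
    convert (hb i).1.smul (inv_nonneg.mpr hb1.le) using 1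
    rw [smul_sub, smul_smul, inv_mul_cancel₀ hb1.ne', one_smul]
  have hstep : ∀ {a : ℝ} {k : ℕ}, 0 ≤ a → (∀ i, LoewnerClose a (R i k)⁻¹ (Rlim i)⁻¹) →
      (∀ i, LoewnerClose a (Pseq k i) (P i)) →
      ∀ i, LoewnerClose ((1 - ε) * a) (Pseq (k + 1) i) (P i) := by
    intro a k ha hR hclose i
    have hS' : LoewnerClose a ((C i)ᵀ * (R i k)⁻¹ * C i) ((C i)ᵀ * (Rlim i)⁻¹ * C i) := by
      simpa using (hR i).mul_mul_transpose (C i)ᵀ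
    have hinfo := (LoewnerClose.sum Finset.univ fun j _ =>
      ((hclose j).inv (hPseq k j) (hP j) ha).smul (hLnonneg i j)).add hS'
    have hgain := (hinfo.inv
      (PosDef.sum_smul_add (hLnonneg i) (hLdiag i) (fun j => (hPseq k j).inv) (hS i (hRk i k)))
      (PosDef.sum_smul_add (hLnonneg i) (hLdiag i) (fun j => (hP j).inv) (hS i (hRlim i)))
      ha).mul_mul_transpose A
    rw [hrec, heq i]
    refine hgain.add_right_contract ha hε.le hε1 ?_ ?_
    · rw [← heq i]
      exact (hP i).posSemidef
    · rw [← heq i]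
      exact hεQ i
  suffices hev : ∀ δ : ℝ, 0 < δ → ∀ᶠ k in atTop, ∀ i, LoewnerClose δ (Pseq k i) (P i) from
    fun i => tendsto_of_eventually_loewnerClose (hP i).posSemidef (fun k => (hPseq k i).1)
      fun δ hδ => (hev δ hδ).mono fun k hk => hk i
  intro δ hδ
  obtain ⟨K, hK⟩ := eventually_atTop.mp (eventually_all.mpr fun i =>
    LoewnerClose.eventually_of_tendsto (hRlim i).inv ((hRlim i).tendsto_inv (hRconv i))
      (fun k => (hRk i k).inv.1) (half_pos hδ))
  obtain ⟨c, hc, hc0⟩ := ((eventually_all.mpr fun i =>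
    LoewnerClose.eventually_atTop (hPseq K i) (hP i)).and (eventually_ge_atTop (0 : ℝ))).exists
  have hr0 : 0 ≤ 1 - ε := by linarith
  have hiter : ∀ t i, LoewnerClose (δ / 2 + (1 - ε) ^ t * c) (Pseq (K + t) i) (P i) := by
    intro t
    induction t with
    | zero =>
      exact fun i => (hc i).mono (hPseq K i).posSemidef (hP i).posSemidef (by simp; linarith)
    | succ t ih =>
      have hnonneg : 0 ≤ (1 - ε) ^ t * c := by positivity
      intro i
      refine (hstep (by linarith) (fun j => (hK (K + t) (by omega) j).mono
        (hRk j _).inv.posSemidef (hRlim j).inv.posSemidef (by linarith)) ih i).mono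
        (hPseq _ i).posSemidef (hP i).posSemidef ?_
      rw [pow_succ]
      nlinarith
  have hsmall : ∀ᶠ t : ℕ in atTop, (1 - ε) ^ t * c < δ / 2 := by
    have hlim := (tendsto_pow_atTop_nhds_zero_of_lt_one hr0 (by linarith)).mul_const c
    rw [zero_mul] at hlim
    exact hlim.eventually (gt_mem_nhds (half_pos hδ))
  obtain ⟨T, hT⟩ := eventually_atTop.mp hsmall
  refine eventually_atTop.mpr ⟨K + T, fun k hk i => ?_⟩
  obtain ⟨t, rfl⟩ : ∃ t, k = K + t := ⟨k - K, by omega⟩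
  exact (hiter t i).mono (hPseq _ i).posSemidef (hP i).posSemidef
    (by linarith [hT t (by omega)])
end
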